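/- arXiv:2412.19644 — 2 statements merged into one kernel-verified Lean document; each statement's English description precedes it below -/
import Mathlib

section
/- For all large Q and x (with no requirement that Q ≤ x), V(ℕ,x,Q) = x² ∫_{x/Q}^{2x/Q} {v}(1−{v}) dv/v³ + O(Q log² Q + x), where {·} denotes the fractional part and the implied constant is absolute. -/
open scoped Classical

/-- `𝒜(z;q,b) := Σ_{n ≤ z, n ≡ b (mod q)} a_n`, for a real sequence `a`. -/
noncomputable def seqSum (a : ℕ → ℝ) (z : ℝ) (q b : ℕ) : ℝ :=
  ∑ n ∈ (Finset.Icc 1 ⌊z⌋₊).filter (fun n => n % q = b % q), a n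

/-- `Aver(𝒜,z;q,h) := (1/φ(q/h)) Σ_{1 ≤ b ≤ q, (b,q)=h} 𝒜(z;q,b)`, for `h ∣ q`. -/
noncomputable def seqAver (a : ℕ → ℝ) (z : ℝ) (q h : ℕ) : ℝ :=
  (1 / (Nat.totient (q / h) : ℝ)) *
    ∑ b ∈ (Finset.Icc 1 q).filter (fun b => Nat.gcd b q = h), seqSum a z q b

/-- The Barban–Davenport–Halberstam type variance
`V(𝒜,x,Q) := Σ_{Q/2 < q ≤ Q} Σ_{1 ≤ b ≤ q} |𝒜(x;q,b) − Aver(𝒜,x;q,(b,q))|²`. -/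
noncomputable def varV (a : ℕ → ℝ) (x Q : ℝ) : ℝ :=
  ∑ q ∈ Finset.Ioc ⌊Q / 2⌋₊ ⌊Q⌋₊, ∑ b ∈ Finset.Icc 1 q,
    (seqSum a x q b - seqAver a x q (Nat.gcd b q)) ^ 2

open Finset ArithmeticFunction
open scoped ArithmeticFunction.Moebius

/-- Numbers up to `r` whose gcd with `h * d` equals `h` are the multiples `h * m` with `m` coprime
to `d`. -/
lemma card_gcd_eq_left (r d : ℕ) {h : ℕ} (hh : 0 < h) :
    #{b ∈ Icc 1 r | Nat.gcd b (h * d) = h} = #{m ∈ Icc 1 (r / h) | Nat.gcd m d = 1} := by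
  symm
  refine Finset.card_bij (fun m _ => h * m) ?_ ?_ ?_
  · intro m hm
    simp only [mem_filter, mem_Icc] at hm ⊢
    refine ⟨⟨Nat.mul_pos hh hm.1.1, ?_⟩, ?_⟩
    · rw [mul_comm]
      exact (Nat.le_div_iff_mul_le hh).1 hm.1.2
    · rw [Nat.gcd_mul_left, hm.2, mul_one]
  · intro m _ m' _ hmm
    exact Nat.eq_of_mul_eq_mul_left hh hmm
  · intro b hb
    simp only [mem_filter, mem_Icc] at hb
    obtain ⟨m, rfl⟩ : h ∣ b := by
      conv_lhs => rw [← hb.2]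
      exact Nat.gcd_dvd_left _ _
    refine ⟨m, ?_, rfl⟩
    simp only [mem_filter, mem_Icc]
    refine ⟨⟨Nat.pos_of_mul_pos_left hb.1.1, ?_⟩, ?_⟩
    · rw [Nat.le_div_iff_mul_le hh, mul_comm]
      exact hb.1.2
    · have := hb.2
      rw [Nat.gcd_mul_left] at this
      exact Nat.eq_of_mul_eq_mul_left hh (by rw [this, mul_one])

lemma card_coprime_eq_sum_moebius (y : ℕ) {d : ℕ} (hd : d ≠ 0) :
    (#{m ∈ Icc 1 y | Nat.gcd m d = 1} : ℤ) = ∑ e ∈ d.divisors, μ e * ((y / e : ℕ) : ℤ) := by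
  have hμ : ∀ m, (if Nat.gcd m d = 1 then (1 : ℤ) else 0) =
      ∑ e ∈ d.divisors, if e ∣ m then μ e else 0 := by
    intro m
    rw [← sum_filter, ← one_apply, ← coe_zeta_mul_moebius, coe_zeta_mul_apply]
    refine sum_congr ?_ fun _ _ => rfl
    ext e
    simp only [Nat.mem_divisors, mem_filter, Nat.dvd_gcd_iff]
    have := Nat.gcd_ne_zero_right (m := m) hd
    tauto
  rw [card_filter, Nat.cast_sum]
  simp_rw [Nat.cast_ite, Nat.cast_one, Nat.cast_zero, hμ]
  rw [sum_comm]
  refine sum_congr rfl fun e _ => ?_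
  rw [← sum_filter, sum_const, ← Nat.Ioc_filter_dvd_card_eq_div, nsmul_eq_mul, mul_comm]
  rfl

lemma card_coprime_self (d : ℕ) : #{m ∈ Icc 1 d | Nat.gcd m d = 1} = d.totient := by
  rw [← Nat.filter_coprime_Ico_eq_totient d 1]
  congr 1
  ext m
  simp only [mem_filter, mem_Icc, mem_Ico, Nat.coprime_iff_gcd_eq_one, Nat.gcd_comm d]
  omega

/-- The density of a reduced residue class condition, with the divisor function as error. -/
lemma abs_card_gcd_eq_sub_le (r : ℕ) {q h : ℕ} (hq : 0 < q) (hh : h ∣ q) :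
    |(#{b ∈ Icc 1 r | Nat.gcd b q = h} : ℝ) - (q / h).totient * (r / q)|
      ≤ #(q / h).divisors := by
  obtain ⟨d, rfl⟩ := hh
  have hh : 0 < h := Nat.pos_of_mul_pos_right hq
  have hd : 0 < d := Nat.pos_of_mul_pos_left hq
  rw [card_gcd_eq_left r d hh, Nat.mul_div_cancel_left _ hh]
  have e1 : (#{m ∈ Icc 1 (r / h) | Nat.gcd m d = 1} : ℝ)
      = ∑ e ∈ d.divisors, (μ e : ℝ) * ((r / h / e : ℕ) : ℝ) := by
    have := congrArg (Int.cast : ℤ → ℝ) (card_coprime_eq_sum_moebius (r / h) hd.ne')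
    simpa only [Int.cast_sum, Int.cast_mul, Int.cast_natCast] using this
  have e2 : (d.totient : ℝ) = ∑ e ∈ d.divisors, (μ e : ℝ) * ((d / e : ℕ) : ℝ) := by
    rw [← card_coprime_self]
    have := congrArg (Int.cast : ℤ → ℝ) (card_coprime_eq_sum_moebius d hd.ne')
    simpa only [Int.cast_sum, Int.cast_mul, Int.cast_natCast] using this
  rw [e1, e2, sum_mul, ← sum_sub_distrib, card_eq_sum_ones, Nat.cast_sum]
  refine (abs_sum_le_sum_abs _ _).trans (sum_le_sum fun e he => ?_)
  have hed := Nat.dvd_of_mem_divisors he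
  have he0 : (0 : ℝ) < e := by exact_mod_cast Nat.pos_of_mem_divisors he
  have hμ : |(μ e : ℝ)| ≤ 1 := by exact_mod_cast abs_moebius_le_one (n := e)
  have hd' : (0 : ℝ) < d := by exact_mod_cast hd
  have hh' : (0 : ℝ) < h := by exact_mod_cast hh
  rw [mul_assoc, ← mul_sub, abs_mul, Nat.div_div_eq_div_mul, Nat.cast_div hed he0.ne']
  have hr : (d : ℝ) / e * (r / ((h * d : ℕ) : ℝ)) = (r : ℝ) / ((h * e : ℕ) : ℝ) := by
    push_cast
    field_simp
  rw [hr, ← Nat.floor_div_eq_div (K := ℝ)]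
  have h1 := Nat.floor_le (a := (r : ℝ) / ((h * e : ℕ) : ℝ)) (by positivity)
  have h2 := Nat.lt_floor_add_one ((r : ℝ) / ((h * e : ℕ) : ℝ))
  have h3 : |(⌊(r : ℝ) / ((h * e : ℕ) : ℝ)⌋₊ : ℝ) - (r : ℝ) / ((h * e : ℕ) : ℝ)| ≤ 1 := by
    rw [abs_le]; constructor <;> linarith
  push_cast at h3 ⊢
  calc _ ≤ (1 : ℝ) * 1 := mul_le_mul hμ h3 (abs_nonneg _) zero_le_one
    _ = 1 := one_mul 1

lemma card_gcd_eq_totient {q h : ℕ} (hq : 0 < q) (hh : h ∣ q) :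
    #{b ∈ Icc 1 q | Nat.gcd b q = h} = (q / h).totient := by
  obtain ⟨d, rfl⟩ := hh
  have hh : 0 < h := Nat.pos_of_mul_pos_right hq
  rw [card_gcd_eq_left _ d hh, Nat.mul_div_cancel_left _ hh, card_coprime_self]

lemma seqSum_one (z : ℝ) {q b : ℕ} (hb : b ∈ Icc 1 q) :
    seqSum (fun _ => 1) z q b
      = (⌊z⌋₊ / q : ℕ) + if b ≤ ⌊z⌋₊ % q then (1 : ℝ) else 0 := by
  obtain ⟨hb1, hbq⟩ := mem_Icc.1 hb
  have key : #{n ∈ Icc 1 ⌊z⌋₊ | n % q = b % q}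
      = ⌊z⌋₊ / q + if b ≤ ⌊z⌋₊ % q then 1 else 0 := by
    obtain ⟨c, rfl⟩ : ∃ c, b = c + 1 := ⟨b - 1, by omega⟩
    have := Nat.count_modEq_card ⌊z⌋₊ (r := q) (by omega) c
    rw [Nat.mod_eq_of_lt (show c < q by omega), Nat.count_eq_card_filter_range] at this
    simp only [Nat.add_one_le_iff]
    rw [← this]
    symm
    refine Finset.card_bij (fun m _ => m + 1) ?_ ?_ ?_
    · intro m hm
      simp only [mem_filter, mem_range, mem_Icc] at hm ⊢
      exact ⟨by omega, Nat.ModEq.add_right 1 hm.2⟩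
    · intro m _ m' _ hmm
      exact Nat.add_right_cancel hmm
    · intro n hn
      simp only [mem_filter, mem_Icc] at hn
      obtain ⟨m, rfl⟩ : ∃ m, n = m + 1 := ⟨n - 1, by omega⟩
      refine ⟨m, ?_, rfl⟩
      simp only [mem_filter, mem_range]
      exact ⟨by omega, Nat.ModEq.add_right_cancel' 1 hn.2⟩
  rw [seqSum, sum_const, key]
  simp

/-- The variance over residues modulo a single `q`, up to a divisor sum. -/
lemma abs_sum_sq_sub_le (z : ℝ) {q : ℕ} (hq : 0 < q) :
    |∑ b ∈ Icc 1 q, (seqSum (fun _ => 1) z q b - seqAver (fun _ => 1) z q (Nat.gcd b q)) ^ 2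
      - ((⌊z⌋₊ % q : ℕ) - ((⌊z⌋₊ % q : ℕ) : ℝ) ^ 2 / q)|
      ≤ 2 * ∑ d ∈ q.divisors, (#d.divisors : ℝ) := by
  set r := ⌊z⌋₊ % q with hr
  have hrq : r < q := Nat.mod_lt _ hq
  set T : ℕ → ℝ := fun h => #{b ∈ Icc 1 r | Nat.gcd b q = h} with hT
  set F : ℕ → ℝ := fun h => (q / h).totient with hF
  have hq' : (0 : ℝ) < q := by exact_mod_cast hq
  have hFpos : ∀ h ∈ q.divisors, 0 < F h := fun h hh => by
    have := Nat.div_pos (Nat.divisor_le hh) (Nat.pos_of_mem_divisors hh)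
    simp only [hF]
    exact_mod_cast Nat.totient_pos.2 this
  have hind : ∀ h, ∑ b ∈ Icc 1 q with Nat.gcd b q = h, (if b ≤ r then (1 : ℝ) else 0) = T h := by
    intro h
    rw [← sum_filter, sum_const, nsmul_eq_mul, mul_one, filter_filter]
    simp only [hT]
    congr 2
    ext b
    simp only [mem_filter, mem_Icc]
    constructor <;> rintro ⟨h1, h2⟩
    · exact ⟨⟨h1.1, h2.2⟩, h2.1⟩
    · exact ⟨⟨h1.1, by omega⟩, h2, h1.2⟩
  have hcard : ∀ h ∈ q.divisors, (#{b ∈ Icc 1 q | Nat.gcd b q = h} : ℝ) = F h := fun h hh => by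
    rw [card_gcd_eq_totient hq (Nat.dvd_of_mem_divisors hh)]
  have haver : ∀ h ∈ q.divisors,
      seqAver (fun _ => 1) z q h = (⌊z⌋₊ / q : ℕ) + T h / F h := fun h hh => by
    rw [seqAver, sum_congr rfl fun b hb => seqSum_one z (mem_filter.1 hb).1, sum_add_distrib,
      hind, sum_const, nsmul_eq_mul, hcard h hh]
    have := (hFpos h hh).ne'
    change 1 / F h * _ = _
    field_simp
  have hmaps : ∀ s, ∀ b ∈ Icc 1 s, Nat.gcd b q ∈ q.divisors := fun s b _ =>
    Nat.mem_divisors.2 ⟨Nat.gcd_dvd_right _ _, hq.ne'⟩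
  have hvar : ∑ b ∈ Icc 1 q,
      (seqSum (fun _ => 1) z q b - seqAver (fun _ => 1) z q (Nat.gcd b q)) ^ 2
      = ∑ h ∈ q.divisors, (T h - T h ^ 2 / F h) := by
    rw [← sum_fiberwise_of_maps_to (hmaps q)]
    refine sum_congr rfl fun h hh => ?_
    have : ∀ b ∈ (Icc 1 q).filter (fun b => Nat.gcd b q = h),
        (seqSum (fun _ => 1) z q b - seqAver (fun _ => 1) z q (Nat.gcd b q)) ^ 2
        = (if b ≤ r then (1 : ℝ) else 0) * (1 - 2 * (T h / F h)) + (T h / F h) ^ 2 := by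
      intro b hb
      rw [mem_filter] at hb
      rw [hb.2, haver h hh, seqSum_one z hb.1]
      split_ifs <;> ring
    rw [sum_congr rfl this, sum_add_distrib, ← sum_mul, hind, sum_const, nsmul_eq_mul, hcard h hh]
    have := (hFpos h hh).ne'
    field_simp
    ring
  have hTsum : ∑ h ∈ q.divisors, T h = r := by
    have := card_eq_sum_card_fiberwise (hmaps r)
    rw [Nat.card_Icc, Nat.add_sub_cancel] at this
    simp only [hT]
    exact_mod_cast this.symm
  have hFsum : ∑ h ∈ q.divisors, F h = q := by
    simp only [hF]
    rw [Nat.sum_div_divisors q (fun d => (d.totient : ℝ))]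
    exact_mod_cast Nat.sum_totient q
  have hmain : (r : ℝ) - (r : ℝ) ^ 2 / q = ∑ h ∈ q.divisors, (T h - F h * (r / q) ^ 2) := by
    rw [sum_sub_distrib, hTsum, ← sum_mul, hFsum]
    field_simp
  rw [hvar, hmain, ← sum_sub_distrib, ← Nat.sum_div_divisors q (fun d => (#d.divisors : ℝ)),
    mul_sum]
  refine (abs_sum_le_sum_abs _ _).trans (sum_le_sum fun h hh => ?_)
  have hF0 := hFpos h hh
  have hE : |T h - F h * (r / q)| ≤ #(q / h).divisors :=
    abs_card_gcd_eq_sub_le r hq (Nat.dvd_of_mem_divisors hh)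
  have hTF : T h ≤ F h := by
    rw [← hcard h hh]
    simp only [hT]
    exact_mod_cast card_le_card (filter_subset_filter _ (Icc_subset_Icc le_rfl hrq.le))
  have hT0 : 0 ≤ T h := by simp only [hT]; positivity
  have hρ0 : (0 : ℝ) ≤ r / q := by positivity
  have hρ1 : (r : ℝ) / q ≤ 1 := (div_le_one hq').2 (by exact_mod_cast hrq.le)
  have hfac : T h - T h ^ 2 / F h - (T h - F h * (r / q) ^ 2)
      = (T h - F h * (r / q)) * -(T h / F h + r / q) := by
    have := hF0.ne'
    field_simp
    ring
  have hb : |-(T h / F h + r / q)| ≤ 2 := by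
    rw [abs_neg, abs_of_nonneg (by positivity)]
    have := (div_le_one hF0).2 hTF
    linarith
  rw [hfac, abs_mul, mul_comm (2 : ℝ)]
  exact mul_le_mul hE hb (abs_nonneg _) (by positivity)

/-- The variance `{v} (1 - {v})` of a Bernoulli variable with mean the fractional part of `v`. -/
noncomputable def fractVar (v : ℝ) : ℝ := Int.fract v * (1 - Int.fract v)

lemma fractVar_nonneg (v : ℝ) : 0 ≤ fractVar v :=
  mul_nonneg (Int.fract_nonneg v) (sub_nonneg.2 (Int.fract_lt_one v).le)

lemma fractVar_le_one (v : ℝ) : fractVar v ≤ 1 :=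
  mul_le_one₀ (Int.fract_lt_one v).le (sub_nonneg.2 (Int.fract_lt_one v).le)
    (by linarith [Int.fract_nonneg v])

lemma abs_fractVar_sub_le_of_le {a b : ℝ} (hab : a ≤ b) :
    |fractVar a - fractVar b| ≤ b - a := by
  have ha0 := Int.fract_nonneg a
  have ha1 := Int.fract_lt_one a
  have hb0 := Int.fract_nonneg b
  have hb1 := Int.fract_lt_one b
  have ha := Int.floor_add_fract a
  have hb := Int.floor_add_fract b
  unfold fractVar
  set s := Int.fract a
  set t := Int.fract b
  rcases (Int.floor_mono hab).eq_or_lt with h | h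
  · have hst : b - a = t - s := by
      rw [← ha, ← hb, h]; ring
    have hst0 : 0 ≤ t - s := by linarith
    rw [hst, abs_le]
    constructor <;> nlinarith
  · have h' : (⌊a⌋ : ℝ) + 1 ≤ ⌊b⌋ := by exact_mod_cast h
    rw [abs_le]
    constructor <;> nlinarith

lemma abs_fractVar_sub_le (a b : ℝ) : |fractVar a - fractVar b| ≤ |a - b| := by
  rcases le_total a b with h | h
  · rw [abs_sub_comm a b, abs_of_nonneg (sub_nonneg.2 h)]
    exact abs_fractVar_sub_le_of_le h
  · rw [abs_sub_comm, abs_of_nonneg (sub_nonneg.2 h)]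
    exact abs_fractVar_sub_le_of_le h

lemma continuous_fractVar : Continuous fractVar :=
  (LipschitzWith.of_dist_le' (K := 1) fun a b => by
    simpa [Real.dist_eq] using abs_fractVar_sub_le a b).continuous

lemma mod_sub_sq_div_eq (N : ℕ) {q : ℕ} (hq : 0 < q) :
    ((N % q : ℕ) : ℝ) - ((N % q : ℕ) : ℝ) ^ 2 / q = q * fractVar (N / q) := by
  have hq' : (0 : ℝ) < q := by exact_mod_cast hq
  rw [fractVar, Int.fract_div_natCast_eq_div_natCast_mod]
  field_simp

lemma abs_mul_fractVar_floor_sub_le {x : ℝ} (hx : 0 ≤ x) {q : ℕ} (hq : 0 < q) :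
    |(q : ℝ) * fractVar (⌊x⌋₊ / q) - q * fractVar (x / q)| ≤ 1 := by
  have hq' : (0 : ℝ) < q := by exact_mod_cast hq
  have h1 := Nat.floor_le hx
  have h2 := Nat.lt_floor_add_one x
  rw [← mul_sub, abs_mul, abs_of_pos hq']
  calc (q : ℝ) * |fractVar (⌊x⌋₊ / q) - fractVar (x / q)|
      ≤ q * |(⌊x⌋₊ : ℝ) / q - x / q| := 
        mul_le_mul_of_nonneg_left (abs_fractVar_sub_le _ _) hq'.le
    _ = |(⌊x⌋₊ : ℝ) - x| := by
      rw [← sub_div, abs_div, abs_of_pos hq']; field_simp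
    _ ≤ 1 := by rw [abs_le]; constructor <;> linarith

lemma abs_mul_fractVar_sub_le {x u w : ℝ} (hx : 0 ≤ x) (hu : 0 < u) (huw : u ≤ w)
    (hwu : w ≤ u + 1) :
    |w * fractVar (x / w) - u * fractVar (x / u)| ≤ 1 + x / u := by
  have hw : 0 < w := hu.trans_le huw
  have hle : x / w ≤ x / u := div_le_div_of_nonneg_left hx hu huw
  have h1 := abs_fractVar_sub_le_of_le hle
  have h2 : w * (x / u - x / w) ≤ x / u := by
    have : w * (x / u - x / w) = (w - u) * (x / u) := by field_simp
    rw [this]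
    exact mul_le_of_le_one_left (by positivity) (by linarith)
  have h3 : w * fractVar (x / w) - u * fractVar (x / u)
      = w * (fractVar (x / w) - fractVar (x / u)) + (w - u) * fractVar (x / u) := by ring
  have h4 : (w - u) * fractVar (x / u) ≤ 1 :=
    mul_le_one₀ (by linarith) (fractVar_nonneg _) (fractVar_le_one _)
  have h5 : 0 ≤ (w - u) * fractVar (x / u) :=
    mul_nonneg (by linarith) (fractVar_nonneg _)
  rw [h3]
  refine (abs_add_le _ _).trans ?_
  rw [abs_mul, abs_of_pos hw, abs_of_nonneg h5]
  have := mul_le_mul_of_nonneg_left h1 hw.le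
  linarith

lemma continuousOn_mul_fractVar (x : ℝ) :
    ContinuousOn (fun u : ℝ => u * fractVar (x / u)) (Set.Ioi 0) :=
  continuousOn_id.mul (continuous_fractVar.comp_continuousOn
    (continuousOn_const.div continuousOn_id fun _ hu => ne_of_gt hu))

lemma intervalIntegrable_mul_fractVar (x : ℝ) {a b : ℝ} (ha : 0 < a) (hb : 0 < b) :
    IntervalIntegrable (fun u : ℝ => u * fractVar (x / u)) MeasureTheory.volume a b :=
  ((continuousOn_mul_fractVar x).mono fun _ hu =>
    (lt_min ha hb).trans_le hu.1).intervalIntegrable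

lemma abs_sum_mul_fractVar_sub_integral_le {x : ℝ} (hx : 0 ≤ x) {m n : ℕ} (hm : 0 < m)
    (hmn : m ≤ n) :
    |∑ q ∈ Ioc m n, (q : ℝ) * fractVar (x / q) - ∫ u in (m : ℝ)..n, u * fractVar (x / u)|
      ≤ ((n : ℝ) - m) * (1 + x / m) := by
  have hm' : (0 : ℝ) < m := by exact_mod_cast hm
  have hpos : ∀ k ∈ Ico m n, (m : ℝ) ≤ k := fun k hk => by exact_mod_cast (mem_Ico.1 hk).1
  have hint : ∀ k ∈ Ico m n, IntervalIntegrable (fun u : ℝ => u * fractVar (x / u))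
      MeasureTheory.volume k (k + 1 : ℕ) := fun k hk => by
    have := hpos k hk
    exact intervalIntegrable_mul_fractVar x (hm'.trans_le this) (by positivity)
  have hshift : ∑ q ∈ Ioc m n, (q : ℝ) * fractVar (x / q)
      = ∑ k ∈ Ico m n, ((k + 1 : ℕ) : ℝ) * fractVar (x / (k + 1 : ℕ)) := by
    rw [sum_Ico_add' (fun q : ℕ => (q : ℝ) * fractVar (x / q)) m n 1]
    refine sum_congr ?_ fun _ _ => rfl
    ext q
    simp only [mem_Ioc, mem_Ico]
    omega
  rw [hshift, ← intervalIntegral.sum_integral_adjacent_intervals_Ico (a := fun k : ℕ => (k : ℝ))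
    hmn (fun k hk => hint k (by simpa using hk)), ← sum_sub_distrib]
  refine (abs_sum_le_sum_abs _ _).trans ?_
  have hcard : ((n : ℝ) - m) * (1 + x / m) = ∑ k ∈ Ico m n, (1 + x / m) := by
    rw [sum_const, Nat.card_Ico, nsmul_eq_mul, Nat.cast_sub hmn]
  rw [hcard]
  refine sum_le_sum fun k hk => ?_
  have hk0 := hpos k hk
  have hconst : ((k + 1 : ℕ) : ℝ) * fractVar (x / (k + 1 : ℕ))
      = ∫ _ in (k : ℝ)..(k + 1 : ℕ), ((k + 1 : ℕ) : ℝ) * fractVar (x / (k + 1 : ℕ)) := by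
    rw [intervalIntegral.integral_const]
    push_cast
    simp
  rw [hconst, ← intervalIntegral.integral_sub intervalIntegrable_const (hint k hk)]
  have := intervalIntegral.norm_integral_le_of_norm_le_const (a := (k : ℝ)) (b := (k + 1 : ℕ))
    (C := 1 + x / m)
    (f := fun u => ((k + 1 : ℕ) : ℝ) * fractVar (x / (k + 1 : ℕ)) - u * fractVar (x / u)) ?_
  · simpa using this
  · intro u hu
    rw [Set.uIoc_of_le (by push_cast; linarith)] at hu
    have hu1 := hu.1
    have hu2 := hu.2
    rw [Real.norm_eq_abs]
    refine (abs_mul_fractVar_sub_le hx (by linarith) hu2 (by push_cast; linarith)).trans ?_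
    gcongr
    linarith

lemma abs_integral_mul_fractVar_le {x a b B : ℝ} (ha : 0 < a) (hb : 0 < b) (haB : a ≤ B)
    (hbB : b ≤ B) (hab : |b - a| ≤ 1) : |∫ u in a..b, u * fractVar (x / u)| ≤ B := by
  have := intervalIntegral.norm_integral_le_of_norm_le_const (a := a) (b := b) (C := B)
    (f := fun u => u * fractVar (x / u)) ?_
  · refine this.trans (mul_le_of_le_one_right (by linarith) hab)
  · intro u hu
    have hu0 : 0 < u := (lt_min ha hb).trans hu.1
    have hu1 : u ≤ B := hu.2.trans (max_le haB hbB)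
    rw [Real.norm_eq_abs, abs_of_nonneg (mul_nonneg hu0.le (fractVar_nonneg _))]
    exact (mul_le_of_le_one_right hu0.le (fractVar_le_one _)).trans hu1

/-- The substitution `v = x / u`. -/
lemma sq_mul_integral_fractVar_div_cube {x Q : ℝ} (hx : 0 < x) (hQ : 0 < Q) :
    x ^ 2 * ∫ v in (x / Q)..(2 * x / Q), fractVar v / v ^ 3
      = ∫ u in (Q / 2)..Q, u * fractVar (x / u) := by
  have hpos : ∀ u ∈ Set.uIcc (Q / 2) Q, 0 < u := fun u hu =>
    (lt_min (half_pos hQ) hQ).trans_le hu.1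
  have hsub := intervalIntegral.integral_comp_mul_deriv' (a := Q / 2) (b := Q)
    (f := fun u => x / u) (f' := fun u => -(x / u ^ 2)) (g := fun v => fractVar v / v ^ 3)
    (fun u hu => by
      have := ((hasDerivAt_inv (hpos u hu).ne').const_mul x)
      simp only [div_eq_mul_inv]
      convert! this using 1
      ring)
    ((continuousOn_const.div (continuousOn_id.pow 2) fun u hu =>
      (pow_pos (hpos u hu) 2).ne').neg)
    (continuous_fractVar.continuousOn.div (continuousOn_id.pow 3) (by
      rintro _ ⟨u, hu, rfl⟩
      exact (pow_pos (div_pos hx (hpos u hu)) 3).ne'))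
  have he : x / (Q / 2) = 2 * x / Q := by field_simp
  rw [he] at hsub
  rw [intervalIntegral.integral_symm, ← hsub, ← intervalIntegral.integral_neg, ← intervalIntegral.integral_const_mul]
  refine intervalIntegral.integral_congr fun u hu => ?_
  have := hpos u hu
  simp only [Function.comp]
  field_simp

lemma sum_inv_Icc_le (n : ℕ) : ∑ k ∈ Icc 1 n, (k : ℝ)⁻¹ ≤ 1 + Real.log n := by
  have := harmonic_le_one_add_log n
  rw [harmonic_eq_sum_Icc] at this
  simpa only [Rat.cast_sum, Rat.cast_inv, Rat.cast_natCast] using this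

lemma sum_card_divisors_div_le (n : ℕ) :
    ∑ d ∈ Icc 1 n, (#d.divisors : ℝ) / d ≤ (∑ k ∈ Icc 1 n, (k : ℝ)⁻¹) ^ 2 := by
  have h1 : ∀ d ∈ Icc 1 n, (#d.divisors : ℝ) / d
      = ∑ p ∈ (Icc 1 n ×ˢ Icc 1 n) with p.1 * p.2 = d, (p.1 : ℝ)⁻¹ * (p.2 : ℝ)⁻¹ := by
    intro d hd
    rw [mem_Icc] at hd
    have : (Icc 1 n ×ˢ Icc 1 n).filter (fun p => p.1 * p.2 = d) = d.divisorsAntidiagonal := by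
      ext ⟨a, b⟩
      simp only [mem_filter, mem_product, mem_Icc, Nat.mem_divisorsAntidiagonal]
      constructor
      · rintro ⟨_, h⟩
        exact ⟨h, by omega⟩
      · rintro ⟨h, _⟩
        have ha : a ≠ 0 := by rintro rfl; omega
        have hb : b ≠ 0 := by rintro rfl; omega
        have h2 := Nat.le_mul_of_pos_right a (Nat.pos_of_ne_zero hb)
        have h3 := Nat.le_mul_of_pos_left b (Nat.pos_of_ne_zero ha)
        refine ⟨⟨?_, ?_⟩, h⟩ <;> omega
    have hc : #d.divisors = #d.divisorsAntidiagonal := by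
      rw [← Nat.map_div_right_divisors, card_map]
    rw [this, hc, div_eq_mul_inv, ← nsmul_eq_mul, ← sum_const]
    refine sum_congr rfl fun p hp => ?_
    rw [← (Nat.mem_divisorsAntidiagonal.1 hp).1]
    push_cast
    rw [mul_inv]
  rw [sum_congr rfl h1, sq, sum_mul_sum, ← sum_product']
  have := sum_fiberwise_le_sum_of_sum_fiber_nonneg (s := Icc 1 n ×ˢ Icc 1 n) (t := Icc 1 n)
    (g := fun p : ℕ × ℕ => p.1 * p.2) (f := fun p => (p.1 : ℝ)⁻¹ * (p.2 : ℝ)⁻¹)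
    fun _ _ => sum_nonneg fun _ _ => by positivity
  exact this

lemma sum_divisors_sum_card_divisors_le (n : ℕ) :
    ∑ q ∈ Icc 1 n, ∑ d ∈ q.divisors, (#d.divisors : ℝ) ≤ n * (1 + Real.log n) ^ 2 := by
  have hswap : ∑ q ∈ Icc 1 n, ∑ d ∈ q.divisors, (#d.divisors : ℝ)
      = ∑ d ∈ Icc 1 n, ∑ q ∈ Ioc 0 n with d ∣ q, (#d.divisors : ℝ) := by
    refine sum_comm' fun q d => ?_
    simp only [mem_Icc, Nat.mem_divisors, mem_filter, mem_Ioc]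
    constructor
    · rintro ⟨h1, h2, _⟩
      have := Nat.le_of_dvd h1.1 h2
      have := Nat.pos_of_dvd_of_pos h2 h1.1
      exact ⟨⟨⟨by omega, by omega⟩, h2⟩, by omega, by omega⟩
    · rintro ⟨⟨h1, h2⟩, _⟩
      exact ⟨⟨by omega, by omega⟩, h2, by omega⟩
  have hH : 0 ≤ ∑ k ∈ Icc 1 n, (k : ℝ)⁻¹ := sum_nonneg fun _ _ => by positivity
  rw [hswap]
  calc ∑ d ∈ Icc 1 n, ∑ q ∈ Ioc 0 n with d ∣ q, (#d.divisors : ℝ)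
      ≤ ∑ d ∈ Icc 1 n, n * ((#d.divisors : ℝ) / d) := sum_le_sum fun d _ => by
        rw [sum_const, Nat.Ioc_filter_dvd_card_eq_div, nsmul_eq_mul]
        calc ((n / d : ℕ) : ℝ) * #d.divisors ≤ (n / d : ℝ) * #d.divisors := by
              gcongr; exact Nat.cast_div_le
          _ = n * ((#d.divisors : ℝ) / d) := by ring
    _ = n * ∑ d ∈ Icc 1 n, (#d.divisors : ℝ) / d := (mul_sum _ _ _).symm
    _ ≤ n * (∑ k ∈ Icc 1 n, (k : ℝ)⁻¹) ^ 2 := by gcongr; exact sum_card_divisors_div_le n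
    _ ≤ n * (1 + Real.log n) ^ 2 := by gcongr; exact sum_inv_Icc_le n

/-- The variance is a sum of Bernoulli variances, up to a divisor-sum error. -/
lemma abs_varV_sub_sum_le (x : ℝ) {Q : ℝ} (hQ : 1 ≤ Q) :
    |varV (fun _ => 1) x Q - ∑ q ∈ Ioc ⌊Q / 2⌋₊ ⌊Q⌋₊, (q : ℝ) * fractVar (⌊x⌋₊ / q)|
      ≤ 2 * (Q * (1 + Real.log Q) ^ 2) := by
  have hnQ : (⌊Q⌋₊ : ℝ) ≤ Q := Nat.floor_le (by linarith)
  have hn0 : (0 : ℝ) < ⌊Q⌋₊ := by exact_mod_cast Nat.floor_pos.2 hQ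
  have hlog : Real.log ⌊Q⌋₊ ≤ Real.log Q := Real.log_le_log hn0 hnQ
  have hlog0 : 0 ≤ Real.log ⌊Q⌋₊ := Real.log_natCast_nonneg _
  have hpos : ∀ q ∈ Ioc ⌊Q / 2⌋₊ ⌊Q⌋₊, 0 < q := fun q hq => by
    have := (mem_Ioc.1 hq).1
    omega
  rw [varV, ← sum_sub_distrib]
  calc _ ≤ ∑ q ∈ Ioc ⌊Q / 2⌋₊ ⌊Q⌋₊, 2 * ∑ d ∈ q.divisors, (#d.divisors : ℝ) :=
        (abs_sum_le_sum_abs _ _).trans (sum_le_sum fun q hq => by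
          rw [← mod_sub_sq_div_eq _ (hpos q hq)]
          exact abs_sum_sq_sub_le x (hpos q hq))
    _ ≤ ∑ q ∈ Icc 1 ⌊Q⌋₊, 2 * ∑ d ∈ q.divisors, (#d.divisors : ℝ) :=
        sum_le_sum_of_subset_of_nonneg
          (fun q hq => mem_Icc.2 ⟨hpos q hq, (mem_Ioc.1 hq).2⟩) fun _ _ _ => by positivity
    _ ≤ 2 * (⌊Q⌋₊ * (1 + Real.log ⌊Q⌋₊) ^ 2) := by
        rw [← mul_sum]
        exact mul_le_mul_of_nonneg_left (sum_divisors_sum_card_divisors_le _) zero_le_two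
    _ ≤ 2 * (Q * (1 + Real.log Q) ^ 2) := by gcongr

lemma abs_sum_mul_fractVar_floor_sub_le {x : ℝ} (hx : 0 ≤ x) {m n : ℕ} (hmn : m ≤ n) :
    |∑ q ∈ Ioc m n, (q : ℝ) * fractVar (⌊x⌋₊ / q) - ∑ q ∈ Ioc m n, (q : ℝ) * fractVar (x / q)|
      ≤ (n : ℝ) - m := by
  rw [← sum_sub_distrib]
  calc _ ≤ ∑ q ∈ Ioc m n, (1 : ℝ) :=
        (abs_sum_le_sum_abs _ _).trans (sum_le_sum fun q hq =>
          abs_mul_fractVar_floor_sub_le hx (Nat.zero_lt_of_lt (mem_Ioc.1 hq).1))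
    _ = (n : ℝ) - m := by
        rw [sum_const, Nat.card_Ioc, nsmul_eq_mul, mul_one, Nat.cast_sub hmn]

/-- Lemma 3 of the paper: for all large `Q` and `x` (with no requirement that `Q ≤ x`),
`V(ℕ,x,Q) = x² ∫_{x/Q}^{2x/Q} {v}(1−{v}) dv/v³ + O(Q log² Q + x)`, where `{·}` is the
fractional part and the implied constant is absolute. -/
theorem statement_6 :
    ∃ C : ℝ, 0 < C ∧ ∀ x Q : ℝ, C ≤ x → C ≤ Q →
      |varV (fun _ => 1) x Q -
          x ^ 2 * ∫ v in (x / Q)..(2 * x / Q), Int.fract v * (1 - Int.fract v) / v ^ 3|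
        ≤ C * (Q * (Real.log Q) ^ 2 + x) := by
  refine ⟨12, by norm_num, fun x Q hx hQ => ?_⟩
  change |_ - x ^ 2 * ∫ v in (x / Q)..(2 * x / Q), fractVar v / v ^ 3| ≤ _
  rw [sq_mul_integral_fractVar_div_cube (by linarith) (by linarith)]
  set m := ⌊Q / 2⌋₊
  set n := ⌊Q⌋₊
  have hmQ : (m : ℝ) ≤ Q / 2 := Nat.floor_le (by linarith)
  have hQm : Q / 2 < m + 1 := Nat.lt_floor_add_one _
  have hnQ : (n : ℝ) ≤ Q := Nat.floor_le (by linarith)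
  have hQn : Q < n + 1 := Nat.lt_floor_add_one _
  have hmn : m ≤ n := Nat.floor_mono (by linarith)
  have hm4 : Q / 4 ≤ m := by linarith
  have hm0 : (0 : ℝ) < m := by linarith
  have hn0 : (0 : ℝ) < n := by linarith
  have hL : 1 ≤ Real.log Q := by
    rw [Real.le_log_iff_exp_le (by linarith)]
    linarith [Real.exp_one_lt_d9]
  have hA : |varV (fun _ => 1) x Q - ∑ q ∈ Ioc m n, (q : ℝ) * fractVar (⌊x⌋₊ / q)|
      ≤ 8 * (Q * Real.log Q ^ 2) := by
    refine (abs_varV_sub_sum_le x (by linarith)).trans ?_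
    have : (1 + Real.log Q) ^ 2 ≤ (2 * Real.log Q) ^ 2 :=
      pow_le_pow_left₀ (by linarith) (by linarith) 2
    have := mul_le_mul_of_nonneg_left this (show 0 ≤ Q by linarith)
    linarith
  have hB := abs_sum_mul_fractVar_floor_sub_le (x := x) (by linarith) hmn
  have hC : |∑ q ∈ Ioc m n, (q : ℝ) * fractVar (x / q)
      - ∫ u in (m : ℝ)..n, u * fractVar (x / u)| ≤ Q + 4 * x := by
    refine (abs_sum_mul_fractVar_sub_integral_le (by linarith) (by exact_mod_cast hm0)
      hmn).trans ?_
    have h1 : x / m ≤ x / (Q / 4) := div_le_div_of_nonneg_left (by linarith) (by linarith) hm4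
    have h2 : 0 ≤ x / m := div_nonneg (by linarith) hm0.le
    calc ((n : ℝ) - m) * (1 + x / m) ≤ Q * (1 + x / (Q / 4)) :=
          mul_le_mul (by linarith) (by linarith) (by linarith) (by linarith)
      _ = Q + 4 * x := by
          have : Q ≠ 0 := by linarith
          field_simp
  have hsplit : ∫ u in (Q / 2)..Q, u * fractVar (x / u)
      = (∫ u in (Q / 2)..m, u * fractVar (x / u)) + (∫ u in (m : ℝ)..n, u * fractVar (x / u))
        + ∫ u in (n : ℝ)..Q, u * fractVar (x / u) := by
    have hQ0 : 0 < Q := by linarith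
    rw [intervalIntegral.integral_add_adjacent_intervals,
      intervalIntegral.integral_add_adjacent_intervals] <;>
    exact intervalIntegrable_mul_fractVar x (by linarith) (by linarith)
  have hD := abs_integral_mul_fractVar_le (x := x) (a := Q / 2) (b := m) (B := Q) (by linarith)
    hm0 (by linarith) (by linarith) (by rw [abs_le]; constructor <;> linarith)
  have hE := abs_integral_mul_fractVar_le (x := x) (a := n) (b := Q) (B := Q) hn0
    (by linarith) (by linarith) le_rfl (by rw [abs_le]; constructor <;> linarith)
  have hQL : Q ≤ Q * Real.log Q ^ 2 :=
    le_mul_of_one_le_right (by linarith) (one_le_pow₀ hL)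
  rw [hsplit]
  rw [abs_le] at hA hB hC hD hE ⊢
  constructor <;> linarith [hA.1, hA.2, hB.1, hB.2, hC.1, hC.2, hD.1, hD.2, hE.1, hE.2]
end

section
/- Let √(2x) < Q ≤ x be large and let 𝒜 = (a_n)_{n ≤ x} be a real sequence satisfying the Progressions Condition with parameter K_prog. Then V(𝒜,x,Q) = (Q/2) Σ_{n ≤ x} a_n² + 2 Σ_{h ≤ 2x/Q} Σ_{0 ≤ l ≤ 2x/(Qh)} Σ_{(n₁,n₂) ∈ 𝒮_{h,l}} a_{n₁h} a_{n₂h} C_{n₁n₂, l+1, Q/h} − 2 Σ_{2x/Q < h ≤ Q} Σ_{n₂ < n₁ ≤ x, h | n₁, h | n₂} a_{n₁} a_{n₂} Σ_{Q/(2h) < d ≤ Q/h, (n₁n₂/h², d)=1} 1/φ(d) + O( Σ_{n ≤ x} a_n² τ(n) + (Σ_{n ≤ x} |a_n|)²/K_prog ), with an absolute implied constant. -/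
open scoped Classical

/-- `τ(n)`: the number of divisors of `n`. -/
def tau (n : ℕ) : ℕ := n.divisors.card

/-- `C_{m,l,z} := Σ_{l/2 ≤ d < l, (d,m)=1} 1/φ(d) − Σ_{z/2 < d ≤ z, (d,m)=1} 1/φ(d)`. -/
noncomputable def Cmlz (m : ℕ) (l z : ℝ) : ℝ :=
  (∑ d ∈ (Finset.Icc 1 ⌈l⌉₊).filter
      (fun d : ℕ => l / 2 ≤ (d : ℝ) ∧ (d : ℝ) < l ∧ Nat.Coprime d m), 1 / (Nat.totient d : ℝ)) -
  (∑ d ∈ (Finset.Icc 1 ⌈z⌉₊).filter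
      (fun d : ℕ => z / 2 < (d : ℝ) ∧ (d : ℝ) ≤ z ∧ Nat.Coprime d m), 1 / (Nat.totient d : ℝ))

/-- `𝒮_{h,l} := {(n₁,n₂) : 1 ≤ n₂ < n₁ ≤ x/h, lQ/2 < n₁ − n₂ ≤ (l+1)Q/2}`. -/
noncomputable def Shl (x Q : ℝ) (h l : ℕ) : Finset (ℕ × ℕ) :=
  (Finset.Icc 1 ⌊x / h⌋₊ ×ˢ Finset.Icc 1 ⌊x / h⌋₊).filter
    (fun p : ℕ × ℕ => p.2 < p.1 ∧ (l : ℝ) * Q / 2 < (p.1 : ℝ) - (p.2 : ℝ) ∧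
      (p.1 : ℝ) - (p.2 : ℝ) ≤ ((l : ℝ) + 1) * Q / 2)

/-- The left-hand side of the Progressions Condition: `Σ_{1 ≤ r ≤ 2x/Q} Σ_{1 ≤ b ≤ r}
(Σ_{n ≤ x, n ≡ b (mod r)} |a_n|) · max_{z ≤ x} |𝒜(z;r,b) − Aver(𝒜,z;r,(b,r))|`. -/
noncomputable def progLHS (a : ℕ → ℝ) (x Q : ℝ) : ℝ :=
  ∑ r ∈ Finset.Icc 1 ⌊2 * x / Q⌋₊, ∑ b ∈ Finset.Icc 1 r,
    (∑ n ∈ (Finset.Icc 1 ⌊x⌋₊).filter (fun n => n % r = b % r), |a n|) *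
      (⨆ z ∈ Set.Icc (0 : ℝ) x, |seqSum a z r b - seqAver a z r (Nat.gcd b r)|)

/-- Every residue class modulo `q` has exactly one representative in `[1, q]`. -/
lemma sum_ite_residue {q : ℕ} (hq : 0 < q) (n : ℕ) (c : ℝ) :
    ∑ b ∈ Finset.Icc 1 q, (if n % q = b % q then c else 0) = c := by
  have hlt := Nat.mod_lt n hq
  rw [Finset.sum_eq_single (if n % q = 0 then q else n % q)]
  · split_ifs with h0 h1 h1
    · rfl
    · rw [h0, Nat.mod_self] at h1
      exact absurd rfl h1
    · rfl
    · rw [Nat.mod_mod] at h1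
      exact absurd rfl h1
  · intro b hb hne
    rw [Finset.mem_Icc] at hb
    rw [if_neg]
    intro h
    apply hne
    rcases hb.2.lt_or_eq with hbq | rfl
    · rw [Nat.mod_eq_of_lt hbq] at h
      rw [if_neg (by omega), h]
    · rw [Nat.mod_self] at h
      rw [if_pos h]
  · intro h
    exfalso
    apply h
    rw [Finset.mem_Icc]
    split_ifs <;> omega

lemma sum_residue_fiberwise {q : ℕ} (hq : 0 < q) (S : Finset ℕ) (F : ℕ → ℕ → ℝ) (G : ℕ → ℝ)
    (h : ∀ b n, n % q = b % q → F b n = G n) :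
    ∑ b ∈ Finset.Icc 1 q, ∑ n ∈ S.filter (fun n => n % q = b % q), F b n = ∑ n ∈ S, G n := by
  simp_rw [Finset.sum_filter]
  rw [Finset.sum_comm]
  refine Finset.sum_congr rfl fun n _ => ?_
  rw [← sum_ite_residue hq n (G n)]
  refine Finset.sum_congr rfl fun b _ => ?_
  split_ifs with hb
  · exact h b n hb
  · rfl

lemma gcd_eq_of_mod_eq {n b q : ℕ} (h : n % q = b % q) : Nat.gcd n q = Nat.gcd b q :=
  Nat.ModEq.gcd_eq h

lemma card_filter_gcd_eq {q h : ℕ} (hh : h ∣ q) :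
    ((Finset.Icc 1 q).filter (fun b => Nat.gcd b q = h)).card = Nat.totient (q / h) := by
  rw [Nat.totient_div_of_dvd hh]
  have h1 : Finset.Icc 1 q = Finset.Ico 1 (1 + q) := by ext; simp; omega
  rw [h1, Nat.filter_Ico_card_eq_of_periodic, Nat.count_eq_card_filter_range]
  · simp_rw [Nat.gcd_comm]
  · intro n
    simp

lemma seqAver_eq (a : ℕ → ℝ) (z : ℝ) {q : ℕ} (hq : 0 < q) (h : ℕ) :
    seqAver a z q h = (1 / (Nat.totient (q / h) : ℝ)) *
      ∑ n ∈ Finset.Icc 1 ⌊z⌋₊, if Nat.gcd n q = h then a n else 0 := by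
  unfold seqAver seqSum
  congr 1
  rw [Finset.sum_filter, ← sum_residue_fiberwise hq (Finset.Icc 1 ⌊z⌋₊)
    (fun b n => if Nat.gcd b q = h then a n else 0)]
  · refine Finset.sum_congr rfl fun b _ => ?_
    split_ifs <;> simp
  · intro b n hbn
    simp only [gcd_eq_of_mod_eq hbn]

/-- The indicator of the congruence `n₁ ≡ n₂ (mod q)`. -/
noncomputable def congWeight (q n₁ n₂ : ℕ) : ℝ := if n₁ % q = n₂ % q then 1 else 0

/-- The expected value of `congWeight q n₁ n₂` given the greatest common divisors with `q`. -/
noncomputable def gcdWeight (q n₁ n₂ : ℕ) : ℝ :=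
  if Nat.gcd n₁ q = Nat.gcd n₂ q then 1 / (Nat.totient (q / Nat.gcd n₁ q) : ℝ) else 0

lemma seqSum_eq_congWeight (a : ℕ → ℝ) (z : ℝ) (q n : ℕ) :
    seqSum a z q n = ∑ m ∈ Finset.Icc 1 ⌊z⌋₊, a m * congWeight q n m := by
  unfold seqSum congWeight
  rw [Finset.sum_filter]
  refine Finset.sum_congr rfl fun m _ => ?_
  simp [eq_comm]

lemma seqAver_eq_gcdWeight (a : ℕ → ℝ) (z : ℝ) {q : ℕ} (hq : 0 < q) (n : ℕ) :
    seqAver a z q (Nat.gcd n q) = ∑ m ∈ Finset.Icc 1 ⌊z⌋₊, a m * gcdWeight q n m := by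
  rw [seqAver_eq a z hq, Finset.mul_sum]
  refine Finset.sum_congr rfl fun m _ => ?_
  unfold gcdWeight
  by_cases h : Nat.gcd m q = Nat.gcd n q
  · rw [if_pos h, if_pos h.symm, mul_comm]
  · rw [if_neg h, if_neg (Ne.symm h), mul_zero, mul_zero]

lemma sum_seqAver_sq (a : ℕ → ℝ) (z : ℝ) {q : ℕ} (hq : 0 < q) :
    ∑ b ∈ Finset.Icc 1 q, seqAver a z q (Nat.gcd b q) ^ 2 =
      ∑ b ∈ Finset.Icc 1 q, seqSum a z q b * seqAver a z q (Nat.gcd b q) := by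
  have key : ∀ b, seqAver a z q (Nat.gcd b q) ^ 2 =
      ∑ b' ∈ Finset.Icc 1 q, if Nat.gcd b q = Nat.gcd b' q then
        seqSum a z q b' * (seqAver a z q (Nat.gcd b' q) *
          (1 / (Nat.totient (q / Nat.gcd b' q) : ℝ))) else 0 := by
    intro b
    rw [sq]
    nth_rw 2 [seqAver]
    rw [Finset.sum_filter, Finset.mul_sum, Finset.mul_sum]
    refine Finset.sum_congr rfl fun b' _ => ?_
    by_cases h : Nat.gcd b q = Nat.gcd b' q
    · rw [if_pos h, if_pos h.symm, h]
      ring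
    · rw [if_neg h, if_neg (Ne.symm h)]
      ring
  simp_rw [key]
  rw [Finset.sum_comm]
  refine Finset.sum_congr rfl fun b' _ => ?_
  rw [← Finset.sum_filter, Finset.sum_const, card_filter_gcd_eq (Nat.gcd_dvd_right _ _),
    nsmul_eq_mul]
  have : (0 : ℝ) < Nat.totient (q / Nat.gcd b' q) := by
    exact_mod_cast Nat.totient_pos.2 (Nat.div_pos (Nat.le_of_dvd hq (Nat.gcd_dvd_right _ _))
      (Nat.gcd_pos_of_pos_right _ hq))
  field_simp

lemma sum_variance_modulus (a : ℕ → ℝ) (x : ℝ) {q : ℕ} (hq : 0 < q) :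
    ∑ b ∈ Finset.Icc 1 q, (seqSum a x q b - seqAver a x q (Nat.gcd b q)) ^ 2 =
      ∑ n ∈ Finset.Icc 1 ⌊x⌋₊, ∑ m ∈ Finset.Icc 1 ⌊x⌋₊,
        a n * a m * (congWeight q n m - gcdWeight q n m) := by
  have expand : ∑ b ∈ Finset.Icc 1 q, (seqSum a x q b - seqAver a x q (Nat.gcd b q)) ^ 2 =
      ∑ b ∈ Finset.Icc 1 q, seqSum a x q b * (seqSum a x q b - seqAver a x q (Nat.gcd b q)) := by
    have : ∀ b, (seqSum a x q b - seqAver a x q (Nat.gcd b q)) ^ 2 =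
        seqSum a x q b * (seqSum a x q b - seqAver a x q (Nat.gcd b q)) +
        (seqAver a x q (Nat.gcd b q) ^ 2 - seqSum a x q b * seqAver a x q (Nat.gcd b q)) := by
      intro b; ring
    simp_rw [this]
    rw [Finset.sum_add_distrib, Finset.sum_sub_distrib, sum_seqAver_sq a x hq, sub_self, add_zero]
  rw [expand]
  have fib : ∀ b, seqSum a x q b * (seqSum a x q b - seqAver a x q (Nat.gcd b q)) =
      ∑ n ∈ (Finset.Icc 1 ⌊x⌋₊).filter (fun n => n % q = b % q),
        a n * (seqSum a x q b - seqAver a x q (Nat.gcd b q)) := by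
    intro b
    rw [← Finset.sum_mul, ← seqSum]
  simp_rw [fib]
  rw [sum_residue_fiberwise hq (Finset.Icc 1 ⌊x⌋₊)
    (fun b n => a n * (seqSum a x q b - seqAver a x q (Nat.gcd b q)))
    (fun n => a n * (seqSum a x q n - seqAver a x q (Nat.gcd n q)))]
  · refine Finset.sum_congr rfl fun n _ => ?_
    rw [seqSum_eq_congWeight, seqAver_eq_gcdWeight a x hq, ← Finset.sum_sub_distrib,
      Finset.mul_sum]
    exact Finset.sum_congr rfl fun m _ => by ring
  · intro b n hbn
    simp only [seqSum, hbn, gcd_eq_of_mod_eq hbn]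

lemma sqrt_inv_bound {p : ℕ} (hp : p.Prime) :
    (1 - 1 / (p : ℝ))⁻¹ ≤ (if p = 2 then 2 else 1) * (1 + (Real.sqrt p)⁻¹) := by
  have hp2 : (2 : ℝ) ≤ p := by exact_mod_cast hp.two_le
  have hs : 0 < Real.sqrt p := Real.sqrt_pos.2 (by linarith)
  split_ifs with h
  · subst h
    have : 0 < (Real.sqrt (2 : ℕ))⁻¹ := inv_pos.2 hs
    norm_num at this ⊢
  · have hp3 : (3 : ℝ) ≤ p := by
      have := hp.two_le
      exact_mod_cast (show 3 ≤ p by omega)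
    have hsq : Real.sqrt p * Real.sqrt p = p := Real.mul_self_sqrt (by linarith)
    have hle : Real.sqrt p ≤ p - 1 := by
      rw [Real.sqrt_le_left (by linarith)]
      nlinarith
    have h1 : (1 - 1 / (p : ℝ))⁻¹ = 1 + (p - 1 : ℝ)⁻¹ := by
      have : (p : ℝ) - 1 ≠ 0 := by linarith
      have : (p : ℝ) ≠ 0 := by linarith
      field_simp
      ring
    rw [h1, one_mul]
    gcongr

lemma div_totient_le {n : ℕ} (hn : 0 < n) :
    (n : ℝ) / Nat.totient n ≤ 2 * ∑ e ∈ n.divisors, (Real.sqrt e)⁻¹ := by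
  have h1 : (Nat.totient n : ℝ) = n * ∏ p ∈ n.primeFactors, (1 - 1 / (p : ℝ)) := by
    have := Nat.totient_eq_mul_prod_factors n
    have h2 := congrArg (fun t : ℚ => (t : ℝ)) this
    push_cast at h2
    simpa using h2
  have h2 : (n : ℝ) / Nat.totient n = ∏ p ∈ n.primeFactors, (1 - 1 / (p : ℝ))⁻¹ := by
    rw [h1, Finset.prod_inv_distrib]
    have : (n : ℝ) ≠ 0 := by positivity
    rw [div_mul_eq_div_div, div_self this, one_div]
  rw [h2]
  calc ∏ p ∈ n.primeFactors, (1 - 1 / (p : ℝ))⁻¹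
      ≤ ∏ p ∈ n.primeFactors, ((if p = 2 then 2 else 1) * (1 + (Real.sqrt p)⁻¹)) := by
        refine Finset.prod_le_prod (fun p hp => ?_)
          (fun p hp => sqrt_inv_bound (Nat.prime_of_mem_primeFactors hp))
        have : (2 : ℝ) ≤ p := by exact_mod_cast (Nat.prime_of_mem_primeFactors hp).two_le
        have : 1 / (p : ℝ) ≤ 1 := by rw [div_le_one] <;> linarith
        exact inv_nonneg.2 (by linarith)
    _ = (∏ p ∈ n.primeFactors, (if p = 2 then (2 : ℝ) else 1)) *
          ∏ p ∈ n.primeFactors, (1 + (Real.sqrt p)⁻¹) := Finset.prod_mul_distrib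
    _ ≤ 2 * ∏ p ∈ n.primeFactors, (1 + (Real.sqrt p)⁻¹) := by
        refine mul_le_mul_of_nonneg_right ?_ (Finset.prod_nonneg fun p _ => by positivity)
        rw [Finset.prod_ite_eq']
        split_ifs <;> norm_num
    _ ≤ 2 * ∑ e ∈ n.divisors, (Real.sqrt e)⁻¹ := by
        refine mul_le_mul_of_nonneg_left ?_ (by norm_num)
        calc ∏ p ∈ n.primeFactors, (1 + (Real.sqrt p)⁻¹)
            = ∑ e ∈ n.divisors.filter Squarefree, (Real.sqrt e)⁻¹ := by
              rw [Finset.prod_one_add, Nat.sum_divisors_filter_squarefree hn.ne']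
              refine Finset.sum_congr ?_ fun s _ => ?_
              · rw [Nat.factors_eq]
                rfl
              · have : ∀ s : Finset ℕ, Real.sqrt ((∏ p ∈ s, p : ℕ) : ℝ) = ∏ p ∈ s, Real.sqrt p := by
                  intro s
                  induction s using Finset.induction_on with
                  | empty => simp
                  | insert p s hp ih =>
                    rw [Finset.prod_insert hp, Finset.prod_insert hp, Nat.cast_mul,
                      Real.sqrt_mul (by positivity), ih]
                rw [Finset.prod_inv_distrib, ← this s]
                simp
          _ ≤ ∑ e ∈ n.divisors, (Real.sqrt e)⁻¹ :=
              Finset.sum_le_sum_of_subset_of_nonneg (Finset.filter_subset _ _)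
                fun _ _ _ => by positivity

lemma summable_sqrt_inv_mul_inv : Summable fun e : ℕ => (Real.sqrt e)⁻¹ * (e : ℝ)⁻¹ := by
  have h := Real.summable_nat_rpow_inv (p := 3 / 2) |>.2 (by norm_num)
  refine h.congr fun e => ?_
  rcases Nat.eq_zero_or_pos e with rfl | he
  · norm_num
  · have he' : (0 : ℝ) < e := by exact_mod_cast he
    rw [← mul_inv, Real.sqrt_eq_rpow, show (3 / 2 : ℝ) = 1 / 2 + 1 by norm_num,
      Real.rpow_add he', Real.rpow_one]

lemma sum_div_totient_le (N : ℕ) :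
    ∑ d ∈ Finset.Icc 1 N, (d : ℝ) / Nat.totient d ≤
      2 * (∑' e : ℕ, (Real.sqrt e)⁻¹ * (e : ℝ)⁻¹) * N := by
  calc ∑ d ∈ Finset.Icc 1 N, (d : ℝ) / Nat.totient d
      ≤ ∑ d ∈ Finset.Icc 1 N, 2 * ∑ e ∈ Finset.Icc 1 N,
          if e ∣ d then (Real.sqrt e)⁻¹ else 0 := by
        refine Finset.sum_le_sum fun d hd => ?_
        rw [Finset.mem_Icc] at hd
        refine (div_totient_le hd.1).trans ?_
        rw [← Finset.sum_filter]
        refine mul_le_mul_of_nonneg_left ?_ (by norm_num)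
        refine Finset.sum_le_sum_of_subset_of_nonneg (fun e he => ?_) fun _ _ _ => by positivity
        have hed := Nat.dvd_of_mem_divisors he
        rw [Finset.mem_filter, Finset.mem_Icc]
        exact ⟨⟨Nat.pos_of_dvd_of_pos hed hd.1, (Nat.le_of_dvd hd.1 hed).trans hd.2⟩, hed⟩
    _ = 2 * ∑ e ∈ Finset.Icc 1 N, (N / e : ℕ) * (Real.sqrt e)⁻¹ := by
        rw [← Finset.mul_sum, Finset.sum_comm]
        congr 1
        refine Finset.sum_congr rfl fun e _ => ?_
        rw [← Finset.sum_filter, Finset.sum_const, nsmul_eq_mul]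
        congr 2
        exact Nat.Ioc_filter_dvd_card_eq_div N e
    _ ≤ 2 * ∑ e ∈ Finset.Icc 1 N, ((Real.sqrt e)⁻¹ * (e : ℝ)⁻¹) * N := by
        refine mul_le_mul_of_nonneg_left (Finset.sum_le_sum fun e _ => ?_) (by norm_num)
        have h : ((N / e : ℕ) : ℝ) ≤ N / e := Nat.cast_div_le
        calc ((N / e : ℕ) : ℝ) * (Real.sqrt e)⁻¹ ≤ (N / e) * (Real.sqrt e)⁻¹ := by gcongr
          _ = _ := by ring
    _ ≤ _ := by
        rw [← Finset.sum_mul, mul_assoc]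
        gcongr
        exact summable_sqrt_inv_mul_inv.sum_le_tsum _ fun _ _ => by positivity

/-- The reciprocals of Euler's totient have bounded sums over dyadic intervals. -/
lemma exists_sum_inv_totient_le : ∃ C : ℝ, 0 < C ∧ ∀ (z : ℝ) (S : Finset ℕ), 0 < z →
    (∀ d ∈ S, z / 2 < (d : ℝ) ∧ (d : ℝ) ≤ z) → ∑ d ∈ S, 1 / (Nat.totient d : ℝ) ≤ C := by
  set T := ∑' e : ℕ, (Real.sqrt e)⁻¹ * (e : ℝ)⁻¹ with hT
  have hT0 : 0 ≤ T := tsum_nonneg fun _ => by positivity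
  refine ⟨4 * T + 1, by linarith, fun z S hz hS => ?_⟩
  calc ∑ d ∈ S, 1 / (Nat.totient d : ℝ)
      ≤ ∑ d ∈ S, (2 / z) * ((d : ℝ) / Nat.totient d) := by
        refine Finset.sum_le_sum fun d hd => ?_
        have h1 : 1 ≤ 2 / z * d := by
          rw [div_mul_eq_mul_div, le_div_iff₀ hz]
          linarith [(hS d hd).1]
        rw [← mul_div_assoc]
        gcongr
    _ ≤ (2 / z) * ∑ d ∈ Finset.Icc 1 ⌊z⌋₊, (d : ℝ) / Nat.totient d := by
        rw [← Finset.mul_sum]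
        refine mul_le_mul_of_nonneg_left ?_ (by positivity)
        refine Finset.sum_le_sum_of_subset_of_nonneg (fun d hd => ?_) fun _ _ _ => by positivity
        rw [Finset.mem_Icc]
        refine ⟨?_, Nat.le_floor (hS d hd).2⟩
        have : (0 : ℝ) < d := by linarith [(hS d hd).1]
        exact_mod_cast this
    _ ≤ (2 / z) * (2 * T * ⌊z⌋₊) := by
        gcongr
        exact sum_div_totient_le _
    _ ≤ (2 / z) * (2 * T * z) := by
        gcongr
        exact Nat.floor_le hz.le
    _ ≤ 4 * T + 1 := by
        have : (2 / z) * (2 * T * z) = 4 * T := by field_simp; ring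
        linarith

lemma seqSum_sub_seqAver (a : ℕ → ℝ) (z : ℝ) {r : ℕ} (hr : 0 < r) (n : ℕ) :
    seqSum a z r n - seqAver a z r (Nat.gcd n r) =
      ∑ m ∈ Finset.Icc 1 ⌊z⌋₊, a m * (congWeight r n m - gcdWeight r n m) := by
  rw [seqSum_eq_congWeight, seqAver_eq_gcdWeight a z hr, ← Finset.sum_sub_distrib]
  exact Finset.sum_congr rfl fun m _ => by ring

/-- The largest deviation from the average in the progression of `n` modulo `r`, up to `x`. -/
noncomputable def maxDeviation (a : ℕ → ℝ) (x : ℝ) (r n : ℕ) : ℝ :=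
  ⨆ z ∈ Set.Icc (0 : ℝ) x, |seqSum a z r n - seqAver a z r (Nat.gcd n r)|

lemma abs_le_maxDeviation (a : ℕ → ℝ) {x : ℝ} {r : ℕ} (hr : 0 < r) (n k : ℕ) (hk : (k : ℝ) ≤ x) :
    |∑ m ∈ Finset.Icc 1 k, a m * (congWeight r n m - gcdWeight r n m)| ≤
      maxDeviation a x r n := by
  have hz : (k : ℝ) ∈ Set.Icc (0 : ℝ) x := ⟨by positivity, hk⟩
  have hval : |∑ m ∈ Finset.Icc 1 k, a m * (congWeight r n m - gcdWeight r n m)| =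
      ⨆ _ : (k : ℝ) ∈ Set.Icc (0 : ℝ) x,
        |seqSum a k r n - seqAver a k r (Nat.gcd n r)| := by
    rw [ciSup_pos hz, seqSum_sub_seqAver a k hr, Nat.floor_natCast]
  rw [hval]
  refine le_ciSup (f := fun z : ℝ => ⨆ _ : z ∈ Set.Icc (0 : ℝ) x,
    |seqSum a z r n - seqAver a z r (Nat.gcd n r)|) ?_ (k : ℝ)
  refine ⟨∑ m ∈ Finset.Icc 1 ⌊x⌋₊, |a m * (congWeight r n m - gcdWeight r n m)|, ?_⟩
  rintro _ ⟨z, rfl⟩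
  by_cases hzx : z ∈ Set.Icc (0 : ℝ) x
  · simp only [ciSup_pos hzx]
    rw [seqSum_sub_seqAver a z hr]
    refine (Finset.abs_sum_le_sum_abs _ _).trans
      (Finset.sum_le_sum_of_subset_of_nonneg ?_ fun _ _ _ => abs_nonneg _)
    exact Finset.Icc_subset_Icc_right (Nat.floor_le_floor hzx.2)
  · have : IsEmpty (z ∈ Set.Icc (0 : ℝ) x) := ⟨hzx⟩
    simp only [Real.iSup_of_isEmpty]
    exact Finset.sum_nonneg fun _ _ => abs_nonneg _

lemma abs_sum_window_le (a : ℕ → ℝ) {x Q : ℝ} (hQ : 0 ≤ Q) {r : ℕ} (hr : 0 < r) {n : ℕ}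
    (hn : (n : ℝ) ≤ x) :
    |∑ m ∈ Finset.Icc 1 ⌊x⌋₊, a m *
      (if r * Q / 2 < (n : ℝ) - m ∧ (n : ℝ) - m ≤ r * Q then
        congWeight r n m - gcdWeight r n m else 0)| ≤ 2 * maxDeviation a x r n := by
  set f : ℕ → ℝ := fun m => a m * (congWeight r n m - gcdWeight r n m) with hf
  set u := ⌈(n : ℝ) - r * Q⌉₊ - 1 with hu
  set v := ⌈(n : ℝ) - r * Q / 2⌉₊ - 1 with hv
  have hrQ : 0 ≤ r * Q := by positivity
  have huv : u ≤ v := Nat.sub_le_sub_right (Nat.ceil_le_ceil (by linarith)) 1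
  have hvn : v ≤ n := (Nat.sub_le _ _).trans (Nat.ceil_le.2 (by linarith))
  have hvN : v ≤ ⌊x⌋₊ := hvn.trans (Nat.le_floor hn)
  have hmu : ∀ m : ℕ, 1 ≤ m → (m ≤ u ↔ (m : ℝ) < (n : ℝ) - r * Q) := by
    intro m hm
    rw [← Nat.lt_ceil]
    omega
  have hmv : ∀ m : ℕ, 1 ≤ m → (m ≤ v ↔ (m : ℝ) < (n : ℝ) - r * Q / 2) := by
    intro m hm
    rw [← Nat.lt_ceil]
    omega
  have hcut : ∀ k ≤ ⌊x⌋₊, ∑ m ∈ Finset.Icc 1 k, f m =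
      ∑ m ∈ Finset.Icc 1 ⌊x⌋₊, if m ≤ k then f m else 0 := by
    intro k hk
    rw [← Finset.sum_filter]
    refine Finset.sum_congr ?_ fun _ _ => rfl
    ext m
    simp only [Finset.mem_Icc, Finset.mem_filter]
    omega
  have hsum : ∑ m ∈ Finset.Icc 1 ⌊x⌋₊, a m *
      (if r * Q / 2 < (n : ℝ) - m ∧ (n : ℝ) - m ≤ r * Q then
        congWeight r n m - gcdWeight r n m else 0) =
      ∑ m ∈ Finset.Icc 1 v, f m - ∑ m ∈ Finset.Icc 1 u, f m := by
    rw [hcut v hvN, hcut u (huv.trans hvN), ← Finset.sum_sub_distrib]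
    refine Finset.sum_congr rfl fun m hm => ?_
    have hm1 := (Finset.mem_Icc.1 hm).1
    by_cases h1 : m ≤ u
    · have h2 := (hmu m hm1).1 h1
      rw [if_neg (fun h => by linarith [h.2]), if_pos h1, if_pos (h1.trans huv)]
      ring
    · have h2 := (hmu m hm1).not.1 h1
      by_cases h3 : m ≤ v
      · have h4 := (hmv m hm1).1 h3
        rw [if_pos ⟨by linarith, by linarith⟩, if_pos h3, if_neg h1, sub_zero]
      · have h4 := (hmv m hm1).not.1 h3
        rw [if_neg (fun h => by linarith [h.1]), if_neg h3, if_neg h1]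
        ring
  have hvx : (v : ℝ) ≤ x := le_trans (by exact_mod_cast hvn) hn
  have hux : (u : ℝ) ≤ x := le_trans (by exact_mod_cast huv) hvx
  rw [hsum, two_mul]
  exact (abs_sub _ _).trans
    (add_le_add (abs_le_maxDeviation a hr n v hvx) (abs_le_maxDeviation a hr n u hux))

lemma maxDeviation_congr (a : ℕ → ℝ) (x : ℝ) {r n b : ℕ} (h : n % r = b % r) :
    maxDeviation a x r b = maxDeviation a x r n := by
  simp only [maxDeviation, seqSum, gcd_eq_of_mod_eq h, h]

lemma progLHS_eq (a : ℕ → ℝ) (x Q : ℝ) :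
    progLHS a x Q = ∑ r ∈ Finset.Icc 1 ⌊2 * x / Q⌋₊, ∑ n ∈ Finset.Icc 1 ⌊x⌋₊,
      |a n| * maxDeviation a x r n := by
  unfold progLHS
  refine Finset.sum_congr rfl fun r hr => ?_
  rw [← sum_residue_fiberwise (Finset.mem_Icc.1 hr).1 (Finset.Icc 1 ⌊x⌋₊)
    (fun b n => |a n| * maxDeviation a x r b)]
  · refine Finset.sum_congr rfl fun b _ => ?_
    rw [← Finset.sum_mul, maxDeviation]
  · intro b n h
    simp only [maxDeviation_congr a x h]

lemma abs_sum_windows_le_progLHS (a : ℕ → ℝ) {x Q : ℝ} (hx : 0 ≤ x) (hQ : 0 ≤ Q) :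
    |∑ n ∈ Finset.Icc 1 ⌊x⌋₊, ∑ m ∈ Finset.Icc 1 ⌊x⌋₊, a n * a m *
      ∑ r ∈ Finset.Icc 1 ⌊2 * x / Q⌋₊,
        (if r * Q / 2 < (n : ℝ) - m ∧ (n : ℝ) - m ≤ r * Q then
          congWeight r n m - gcdWeight r n m else 0)| ≤ 2 * progLHS a x Q := by
  have hswap : ∑ n ∈ Finset.Icc 1 ⌊x⌋₊, ∑ m ∈ Finset.Icc 1 ⌊x⌋₊, a n * a m *
      ∑ r ∈ Finset.Icc 1 ⌊2 * x / Q⌋₊,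
        (if r * Q / 2 < (n : ℝ) - m ∧ (n : ℝ) - m ≤ r * Q then
          congWeight r n m - gcdWeight r n m else 0) =
      ∑ r ∈ Finset.Icc 1 ⌊2 * x / Q⌋₊, ∑ n ∈ Finset.Icc 1 ⌊x⌋₊, a n *
        ∑ m ∈ Finset.Icc 1 ⌊x⌋₊, a m *
        (if r * Q / 2 < (n : ℝ) - m ∧ (n : ℝ) - m ≤ r * Q then
          congWeight r n m - gcdWeight r n m else 0) := by
    simp_rw [Finset.mul_sum]
    rw [Finset.sum_comm (s := Finset.Icc 1 ⌊2 * x / Q⌋₊)]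
    refine Finset.sum_congr rfl fun n _ => ?_
    rw [Finset.sum_comm]
    exact Finset.sum_congr rfl fun r _ => Finset.sum_congr rfl fun m _ => by ring
  rw [hswap, progLHS_eq, Finset.mul_sum]
  refine (Finset.abs_sum_le_sum_abs _ _).trans (Finset.sum_le_sum fun r hr => ?_)
  rw [Finset.mul_sum]
  refine (Finset.abs_sum_le_sum_abs _ _).trans (Finset.sum_le_sum fun n hn => ?_)
  rw [abs_mul, mul_left_comm]
  refine mul_le_mul_of_nonneg_left (abs_sum_window_le a hQ (Finset.mem_Icc.1 hr).1 ?_)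
    (abs_nonneg _)
  exact (Nat.le_floor_iff hx).1 (Finset.mem_Icc.1 hn).2

lemma congWeight_of_lt (q : ℕ) {n m : ℕ} (h : m < n) :
    congWeight q n m = if q ∣ n - m then 1 else 0 := by
  unfold congWeight
  refine if_congr ?_ rfl rfl
  rw [eq_comm]
  exact Nat.modEq_iff_dvd' h.le

/-- Switching to the complementary divisor in the difference `n - m`. -/
lemma sum_congWeight_switch {x Q : ℝ} (hQ : 0 < Q) {n m : ℕ} (hmn : m < n) (hn : (n : ℝ) ≤ x) :
    ∑ q ∈ Finset.Ioc ⌊Q / 2⌋₊ ⌊Q⌋₊, congWeight q n m =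
      ∑ r ∈ Finset.Icc 1 ⌊2 * x / Q⌋₊,
        if r * Q / 2 < (n : ℝ) - m ∧ (n : ℝ) - m ≤ r * Q then congWeight r n m else 0 := by
  have hx : 0 ≤ x := le_trans (by positivity) hn
  simp_rw [congWeight_of_lt _ hmn, ← ite_and]
  rw [← Finset.sum_filter, ← Finset.sum_filter]
  rw [← Nat.cast_sub hmn.le]
  have hkx : ((n - m : ℕ) : ℝ) ≤ x := le_trans (by exact_mod_cast Nat.sub_le n m) hn
  have hk : 0 < n - m := Nat.sub_pos_of_lt hmn
  generalize n - m = k at hkx hk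
  refine Finset.sum_nbij' (fun q => k / q) (fun r => k / r) ?_ ?_ ?_ ?_ (fun _ _ => rfl)
  · intro q hq
    simp only [Finset.mem_filter, Finset.mem_Ioc,
      Nat.floor_lt (by positivity : 0 ≤ Q / 2), Nat.le_floor_iff hQ.le] at hq
    obtain ⟨⟨h1, h2⟩, r, rfl⟩ := hq
    have hq0 : 0 < q := Nat.pos_of_mul_pos_right hk
    have hr0 : 0 < r := Nat.pos_of_mul_pos_left hk
    have hr0' : (0 : ℝ) < r := by exact_mod_cast hr0
    rw [Nat.mul_div_cancel_left r hq0]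
    simp only [Finset.mem_filter, Finset.mem_Icc]
    push_cast at hkx ⊢
    have h3 : r * Q / 2 < (q : ℝ) * r := by nlinarith
    refine ⟨⟨hr0, Nat.le_floor ?_⟩, ⟨h3, by nlinarith⟩, Dvd.intro_left q rfl⟩
    rw [le_div_iff₀ hQ]
    linarith
  · intro r hr
    simp only [Finset.mem_filter, Finset.mem_Icc] at hr
    obtain ⟨⟨hr0, -⟩, ⟨h1, h2⟩, q, rfl⟩ := hr
    rw [Nat.mul_div_cancel_left q hr0]
    have hr0' : (0 : ℝ) < r := by exact_mod_cast hr0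
    push_cast at h1 h2
    simp only [Finset.mem_filter, Finset.mem_Ioc,
      Nat.floor_lt (by positivity : 0 ≤ Q / 2), Nat.le_floor_iff hQ.le]
    refine ⟨⟨?_, ?_⟩, Dvd.intro_left r rfl⟩
    · rw [mul_div_assoc] at h1
      exact lt_of_mul_lt_mul_left h1 hr0'.le
    · exact le_of_mul_le_mul_left h2 hr0'
  · intro q hq
    exact Nat.div_div_self (Finset.mem_filter.1 hq).2 hk.ne'
  · intro r hr
    exact Nat.div_div_self (Finset.mem_filter.1 hr).2.2 hk.ne'

lemma gcd_eq_and_gcd_eq_iff {h d n m : ℕ} (hh : 0 < h) (hn : h ∣ n) (hm : h ∣ m) :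
    (Nat.gcd n (h * d) = h ∧ Nat.gcd m (h * d) = h) ↔ Nat.Coprime (n * m / (h * h)) d := by
  obtain ⟨n, rfl⟩ := hn
  obtain ⟨m, rfl⟩ := hm
  rw [mul_mul_mul_comm, Nat.mul_div_cancel_left _ (Nat.mul_pos hh hh), Nat.gcd_mul_left,
    Nat.gcd_mul_left, Nat.mul_eq_left hh.ne', Nat.mul_eq_left hh.ne',
    Nat.coprime_mul_iff_left]

/-- Sorting the moduli `q` by their common value `h` of `(n, q) = (m, q)`. -/
lemma sum_gcdWeight_eq (P : ℕ → Prop) [DecidablePred P] (B : ℕ) (hP : ∀ q, P q → q ≤ B) (n m : ℕ) :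
    ∑ q ∈ (Finset.Icc 1 B).filter P, gcdWeight q n m =
      ∑ h ∈ Finset.Icc 1 B, if h ∣ n ∧ h ∣ m then
        ∑ d ∈ (Finset.Icc 1 B).filter (fun d => P (h * d) ∧ Nat.Coprime (n * m / (h * h)) d),
          1 / (Nat.totient d : ℝ) else 0 := by
  have h1 : ∀ q ∈ (Finset.Icc 1 B).filter P, gcdWeight q n m =
      ∑ h ∈ Finset.Icc 1 B, if Nat.gcd n q = h ∧ Nat.gcd m q = h then
        1 / (Nat.totient (q / h) : ℝ) else 0 := by
    intro q hq
    simp only [Finset.mem_filter, Finset.mem_Icc] at hq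
    rw [Finset.sum_eq_single (Nat.gcd n q)]
    · simp [gcdWeight, eq_comm]
    · intro h _ hne
      rw [if_neg (fun hh => hne hh.1.symm)]
    · intro hh
      exfalso
      apply hh
      rw [Finset.mem_Icc]
      exact ⟨Nat.gcd_pos_of_pos_right _ hq.1.1,
        (Nat.le_of_dvd hq.1.1 (Nat.gcd_dvd_right _ _)).trans hq.1.2⟩
  rw [Finset.sum_congr rfl h1, Finset.sum_comm]
  refine Finset.sum_congr rfl fun h hh => ?_
  have hh0 : 0 < h := (Finset.mem_Icc.1 hh).1
  split_ifs with hdvd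
  · rw [← Finset.sum_filter, Finset.filter_filter]
    symm
    refine Finset.sum_nbij' (fun d => h * d) (fun q => q / h) ?_ ?_ ?_ ?_ ?_
    · intro d hd
      simp only [Finset.mem_filter, Finset.mem_Icc] at hd ⊢
      exact ⟨⟨Nat.mul_pos hh0 hd.1.1, hP _ hd.2.1⟩, hd.2.1,
        (gcd_eq_and_gcd_eq_iff hh0 hdvd.1 hdvd.2).2 hd.2.2⟩
    · intro q hq
      simp only [Finset.mem_filter, Finset.mem_Icc] at hq ⊢
      obtain ⟨⟨hq1, hq2⟩, hPq, hg⟩ := hq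
      obtain ⟨d, rfl⟩ : h ∣ q := hg.1 ▸ Nat.gcd_dvd_right n q
      rw [Nat.mul_div_cancel_left d hh0]
      exact ⟨⟨Nat.pos_of_mul_pos_left hq1, (Nat.le_mul_of_pos_left d hh0).trans hq2⟩, hPq,
        (gcd_eq_and_gcd_eq_iff hh0 hdvd.1 hdvd.2).1 hg⟩
    · intro d _
      exact Nat.mul_div_cancel_left d hh0
    · intro q hq
      have hg := (Finset.mem_filter.1 hq).2.2.1
      exact Nat.mul_div_cancel' (hg ▸ Nat.gcd_dvd_right n q)
    · intro d _
      rw [Nat.mul_div_cancel_left d hh0]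
  · refine Finset.sum_eq_zero fun q _ => if_neg fun hg => hdvd ⟨?_, ?_⟩
    · exact hg.1 ▸ Nat.gcd_dvd_left n q
    · exact hg.2 ▸ Nat.gcd_dvd_left m q

/-- The weight, over moduli `h * d` with `(n - m) / Q ≤ h * d < 2 * (n - m) / Q`, of the pair
`(n, m)` of multiples of `h`. -/
noncomputable def windowWeight (Q : ℝ) (R h n m : ℕ) : ℝ :=
  ∑ d ∈ (Finset.Icc 1 R).filter (fun d =>
    (((h * d : ℕ) : ℝ) * Q / 2 < (n : ℝ) - m ∧ (n : ℝ) - m ≤ ((h * d : ℕ) : ℝ) * Q) ∧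
      Nat.Coprime (n * m / (h * h)) d), 1 / (Nat.totient d : ℝ)

/-- The weight, over moduli `h * d` with `Q / 2 < h * d ≤ Q`, of the pair `(n, m)` of multiples
of `h`. -/
noncomputable def dyadicWeight (Q : ℝ) (h n m : ℕ) : ℝ :=
  ∑ d ∈ (Finset.Icc 1 ⌊Q⌋₊).filter (fun d =>
    (Q / 2 < ((h * d : ℕ) : ℝ) ∧ ((h * d : ℕ) : ℝ) ≤ Q) ∧
      Nat.Coprime (n * m / (h * h)) d), 1 / (Nat.totient d : ℝ)

lemma sum_window_gcdWeight {x Q : ℝ} (hQ : 0 < Q) {n m : ℕ} (hn : (n : ℝ) ≤ x) :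
    ∑ r ∈ Finset.Icc 1 ⌊2 * x / Q⌋₊,
      (if r * Q / 2 < (n : ℝ) - m ∧ (n : ℝ) - m ≤ r * Q then gcdWeight r n m else 0) =
    ∑ h ∈ Finset.Icc 1 ⌊2 * x / Q⌋₊,
      if h ∣ n ∧ h ∣ m then windowWeight Q ⌊2 * x / Q⌋₊ h n m else 0 := by
  rw [← Finset.sum_filter]
  refine sum_gcdWeight_eq (fun r => r * Q / 2 < (n : ℝ) - m ∧ (n : ℝ) - m ≤ r * Q) _ ?_ n m
  intro r hr
  apply Nat.le_floor
  rw [le_div_iff₀ hQ]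
  have : (0 : ℝ) ≤ m := by positivity
  linarith [hr.1]

lemma Ioc_floor_eq_filter {Q : ℝ} (hQ : 0 < Q) : Finset.Ioc ⌊Q / 2⌋₊ ⌊Q⌋₊ =
    (Finset.Icc 1 ⌊Q⌋₊).filter (fun q : ℕ => Q / 2 < (q : ℝ) ∧ (q : ℝ) ≤ Q) := by
  ext q
  simp only [Finset.mem_Ioc, Finset.mem_filter, Finset.mem_Icc,
    Nat.floor_lt (by positivity : 0 ≤ Q / 2), Nat.le_floor_iff hQ.le]
  refine ⟨fun h => ⟨⟨?_, h.2⟩, h⟩, fun h => h.2⟩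
  have : (0 : ℝ) < q := by linarith [h.1]
  exact_mod_cast this

lemma sum_dyadic_gcdWeight {Q : ℝ} (hQ : 0 < Q) (n m : ℕ) :
    ∑ q ∈ Finset.Ioc ⌊Q / 2⌋₊ ⌊Q⌋₊, gcdWeight q n m =
    ∑ h ∈ Finset.Icc 1 ⌊Q⌋₊, if h ∣ n ∧ h ∣ m then dyadicWeight Q h n m else 0 := by
  rw [Ioc_floor_eq_filter hQ]
  exact sum_gcdWeight_eq (fun q : ℕ => Q / 2 < (q : ℝ) ∧ (q : ℝ) ≤ Q) _
    (fun q hq => Nat.le_floor hq.2) n m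

lemma dyadic_mul_iff {Q : ℝ} {h : ℕ} (hh : 0 < h) (d : ℕ) :
    (Q / 2 < ((h * d : ℕ) : ℝ) ∧ ((h * d : ℕ) : ℝ) ≤ Q) ↔
      (Q / h / 2 < (d : ℝ) ∧ (d : ℝ) ≤ Q / h) := by
  have hh' : (0 : ℝ) < h := by exact_mod_cast hh
  rw [div_right_comm Q, div_lt_iff₀ hh', le_div_iff₀ hh', Nat.cast_mul, mul_comm (h : ℝ)]

lemma dyadicWeight_eq_sum {Q : ℝ} (hQ : 0 < Q) {h : ℕ} (hh : 0 < h) (n m : ℕ) :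
    dyadicWeight Q h n m = ∑ d ∈ (Finset.Icc 1 ⌊Q / h⌋₊).filter
      (fun d : ℕ => Q / (2 * h) < (d : ℝ) ∧ Nat.Coprime (n * m / (h * h)) d),
      1 / (Nat.totient d : ℝ) := by
  unfold dyadicWeight
  refine Finset.sum_congr ?_ fun _ _ => rfl
  have hh1 : (1 : ℝ) ≤ h := by exact_mod_cast hh
  have hQh : Q / h ≤ Q := div_le_self hQ.le hh1
  ext d
  simp only [Finset.mem_filter, Finset.mem_Icc, dyadic_mul_iff hh, Nat.le_floor_iff hQ.le,
    Nat.le_floor_iff (by positivity : 0 ≤ Q / h)]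
  rw [show Q / (2 * (h : ℝ)) = Q / h / 2 by rw [div_div, mul_comm]]
  constructor
  · rintro ⟨⟨h1, -⟩, ⟨h3, h4⟩, h5⟩
    exact ⟨⟨h1, h4⟩, h3, h5⟩
  · rintro ⟨⟨h1, h4⟩, h3, h5⟩
    exact ⟨⟨h1, h4.trans hQh⟩, ⟨h3, h4⟩, h5⟩

/-- On `Shl x Q h l` the weight `Cmlz` depends on `l` only through the pair itself. -/
lemma Cmlz_eq {x Q : ℝ} (hx : 0 ≤ x) (hQ : 0 < Q) {h l : ℕ} (hh : 0 < h) {p : ℕ × ℕ}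
    (hp : p ∈ Shl x Q h l) :
    Cmlz (p.1 * p.2) ((l : ℝ) + 1) (Q / h) =
      windowWeight Q ⌊2 * x / Q⌋₊ h (p.1 * h) (p.2 * h) - dyadicWeight Q h (p.1 * h) (p.2 * h) := by
  have hh' : (0 : ℝ) < h := by exact_mod_cast hh
  have hh1 : (1 : ℝ) ≤ h := by exact_mod_cast hh
  simp only [Shl, Finset.mem_filter, Finset.mem_product, Finset.mem_Icc,
    Nat.le_floor_iff (by positivity : 0 ≤ x / h)] at hp
  obtain ⟨⟨⟨-, hp1⟩, -, -⟩, -, hlow, hupp⟩ := hp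
  have hdiv : p.1 * h * (p.2 * h) / (h * h) = p.1 * p.2 := by
    rw [mul_mul_mul_comm, Nat.mul_div_cancel _ (Nat.mul_pos hh hh)]
  have hp2 : (0 : ℝ) ≤ p.2 := by positivity
  unfold Cmlz windowWeight dyadicWeight
  rw [hdiv]
  congr 1
  · refine Finset.sum_congr ?_ fun _ _ => rfl
    ext d
    simp only [Finset.mem_filter, Finset.mem_Icc, Nat.coprime_comm (m := d)]
    push_cast
    have e1 : (h : ℝ) * d * Q / 2 < p.1 * h - p.2 * h ↔ d * Q / 2 < (p.1 : ℝ) - p.2 := by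
      rw [show (h : ℝ) * d * Q / 2 = h * (d * Q / 2) by ring,
        show (p.1 : ℝ) * h - p.2 * h = h * (p.1 - p.2) by ring, mul_lt_mul_iff_right₀ hh']
    have e2 : (p.1 : ℝ) * h - p.2 * h ≤ h * d * Q ↔ (p.1 : ℝ) - p.2 ≤ d * Q := by
      rw [show (h : ℝ) * d * Q = h * (d * Q) by ring,
        show (p.1 : ℝ) * h - p.2 * h = h * (p.1 - p.2) by ring, mul_le_mul_iff_right₀ hh']
    rw [e1, e2]
    have hxh : x / h ≤ x := div_le_self hx hh1
    constructor
    · rintro ⟨⟨hd1, -⟩, h1, h2, h3⟩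
      have hdl : d ≤ l := by
        have : d < l + 1 := by exact_mod_cast h2
        omega
      have hdl' : (d : ℝ) ≤ l := by exact_mod_cast hdl
      refine ⟨⟨hd1, Nat.le_floor ?_⟩, ⟨by nlinarith, by nlinarith⟩, h3⟩
      rw [le_div_iff₀ hQ]
      nlinarith
    · rintro ⟨⟨hd1, -⟩, ⟨h1, h2⟩, h3⟩
      have hd : (d : ℝ) < l + 1 := by
        have : d * Q / 2 < ((l : ℝ) + 1) * Q / 2 := h1.trans_le hupp
        exact lt_of_mul_lt_mul_right (by linarith) hQ.le
      have hd2 : (l : ℝ) < 2 * d := by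
        have : (l : ℝ) * Q / 2 < d * Q := hlow.trans_le h2
        exact lt_of_mul_lt_mul_right (by linarith) hQ.le
      have hd3 : (l : ℝ) + 1 ≤ 2 * d := by
        have : l < 2 * d := by exact_mod_cast hd2
        exact_mod_cast this
      refine ⟨⟨hd1, ?_⟩, by linarith, hd, h3⟩
      exact_mod_cast hd.le.trans (Nat.le_ceil _)
  · refine Finset.sum_congr ?_ fun _ _ => rfl
    have hQh : Q / h ≤ Q := div_le_self hQ.le hh1
    ext d
    simp only [Finset.mem_filter, Finset.mem_Icc, dyadic_mul_iff hh, Nat.coprime_comm (m := d),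
      Nat.le_floor_iff hQ.le]
    constructor
    · rintro ⟨⟨hd1, -⟩, h1, h2, h3⟩
      exact ⟨⟨hd1, h2.trans hQh⟩, ⟨h1, h2⟩, h3⟩
    · rintro ⟨⟨hd1, -⟩, ⟨h1, h2⟩, h3⟩
      refine ⟨⟨hd1, ?_⟩, h1, h2, h3⟩
      exact_mod_cast h2.trans (Nat.le_ceil _)

lemma ceil_two_mul_div_eq {Q k : ℝ} (hQ : 0 < Q) {l : ℕ} (h1 : (l : ℝ) * Q / 2 < k)
    (h2 : k ≤ ((l : ℝ) + 1) * Q / 2) : ⌈2 * k / Q⌉₊ = l + 1 := by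
  rw [Nat.ceil_eq_iff (by omega)]
  push_cast
  rw [lt_div_iff₀ hQ, div_le_iff₀ hQ]
  constructor <;> linarith

/-- The sets `Shl x Q h l` partition the pairs `m < n` of multiples of `h` up to `x`. -/
lemma sum_Shl_eq {x Q : ℝ} (hx : 0 ≤ x) (hQ : 0 < Q) {h : ℕ} (hh : 0 < h) (g : ℕ → ℕ → ℝ) :
    ∑ l ∈ Finset.range (⌊2 * x / (Q * h)⌋₊ + 1), ∑ p ∈ Shl x Q h l, g (p.1 * h) (p.2 * h) =
      ∑ p ∈ (Finset.Icc 1 ⌊x⌋₊ ×ˢ Finset.Icc 1 ⌊x⌋₊).filter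
        (fun p : ℕ × ℕ => p.2 < p.1 ∧ h ∣ p.1 ∧ h ∣ p.2), g p.1 p.2 := by
  have hh' : (0 : ℝ) < h := by exact_mod_cast hh
  rw [Finset.sum_sigma']
  refine Finset.sum_bij' (fun s _ => (s.2.1 * h, s.2.2 * h))
    (fun p _ => ⟨⌈2 * (((p.1 / h : ℕ) : ℝ) - ((p.2 / h : ℕ) : ℝ)) / Q⌉₊ - 1,
      (p.1 / h, p.2 / h)⟩) ?_ ?_ ?_ ?_ ?_
  · rintro ⟨l, n, m⟩ hs
    simp only [Finset.mem_sigma, Shl, Finset.mem_filter, Finset.mem_product, Finset.mem_Icc,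
      Nat.le_floor_iff (by positivity : 0 ≤ x / h), Nat.le_floor_iff hx, le_div_iff₀ hh'] at hs ⊢
    obtain ⟨-, ⟨⟨hn1, hn2⟩, hm1, hm2⟩, hmn, -, -⟩ := hs
    push_cast
    exact ⟨⟨⟨Nat.mul_pos hn1 hh, hn2⟩, Nat.mul_pos hm1 hh, hm2⟩,
      Nat.mul_lt_mul_of_pos_right hmn hh, Dvd.intro_left n rfl, Dvd.intro_left m rfl⟩
  · rintro ⟨n, m⟩ hp
    simp only [Finset.mem_filter, Finset.mem_product, Finset.mem_Icc, Nat.le_floor_iff hx] at hp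
    obtain ⟨⟨⟨hn1, hn2⟩, hm1, hm2⟩, hmn, ⟨n, rfl⟩, ⟨m, rfl⟩⟩ := hp
    have hn0 : 0 < n := Nat.pos_of_mul_pos_left hn1
    have hm0 : 0 < m := Nat.pos_of_mul_pos_left hm1
    have hmn' : m < n := Nat.lt_of_mul_lt_mul_left hmn
    push_cast at hn2 hm2
    simp only [Nat.mul_div_cancel_left _ hh, Finset.mem_sigma, Shl, Finset.mem_filter,
      Finset.mem_product, Finset.mem_Icc, Finset.mem_range,
      Nat.le_floor_iff (by positivity : 0 ≤ x / h), le_div_iff₀ hh']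
    have hk : (0 : ℝ) < (n : ℝ) - m := by
      have : (m : ℝ) < n := by exact_mod_cast hmn'
      linarith
    have hc : 0 < ⌈2 * ((n : ℝ) - m) / Q⌉₊ := Nat.ceil_pos.2 (by positivity)
    have hceil := Nat.le_ceil (2 * ((n : ℝ) - m) / Q)
    have hlt : ((⌈2 * ((n : ℝ) - m) / Q⌉₊ - 1 : ℕ) : ℝ) < 2 * ((n : ℝ) - m) / Q :=
      Nat.lt_ceil.1 (by omega)
    obtain ⟨l, hl⟩ : ∃ l, ⌈2 * ((n : ℝ) - m) / Q⌉₊ = l + 1 := ⟨_, (Nat.succ_pred_eq_of_pos hc).symm⟩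
    rw [hl] at hceil hlt ⊢
    simp only [add_tsub_cancel_right] at hlt ⊢
    push_cast at hceil
    rw [div_le_iff₀ hQ] at hceil
    rw [lt_div_iff₀ hQ] at hlt
    refine ⟨Nat.lt_succ_of_le (Nat.le_floor ?_), ⟨⟨hn0, by linarith⟩, hm0, by linarith⟩, hmn',
      by linarith, by linarith⟩
    rw [le_div_iff₀ (by positivity), ← mul_assoc]
    have : (0 : ℝ) ≤ m * h := by positivity
    nlinarith
  · rintro ⟨l, n, m⟩ hs
    simp only [Finset.mem_sigma, Shl, Finset.mem_filter] at hs
    simp only [Nat.mul_div_cancel _ hh]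
    rw [ceil_two_mul_div_eq hQ hs.2.2.2.1 hs.2.2.2.2, add_tsub_cancel_right]
  · rintro ⟨n, m⟩ hp
    simp only [Finset.mem_filter] at hp
    simp only [Nat.div_mul_cancel hp.2.2.1, Nat.div_mul_cancel hp.2.2.2]
  · intro _ _
    rfl

lemma sum_symm_eq (S : Finset ℕ) (f : ℕ → ℕ → ℝ) (hf : ∀ n m, f n m = f m n) :
    ∑ n ∈ S, ∑ m ∈ S, f n m =
      ∑ n ∈ S, f n n + 2 * ∑ n ∈ S, ∑ m ∈ S, if m < n then f n m else 0 := by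
  have h1 : ∀ n m, f n m = (if n = m then f n m else 0) + (if m < n then f n m else 0) +
      (if n < m then f m n else 0) := by
    intro n m
    rcases lt_trichotomy n m with h | h | h
    · simp [h, h.ne, h.not_gt, hf n m]
    · simp [h]
    · simp [h, h.ne', h.not_gt]
  have h2 : ∑ n ∈ S, ∑ m ∈ S, (if n < m then f m n else 0) =
      ∑ n ∈ S, ∑ m ∈ S, if m < n then f n m else 0 := Finset.sum_comm
  have h3 : ∑ n ∈ S, ∑ m ∈ S, (if n = m then f n m else 0) = ∑ n ∈ S, f n n :=
    Finset.sum_congr rfl fun n hn => by rw [Finset.sum_ite_eq, if_pos hn]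
  calc ∑ n ∈ S, ∑ m ∈ S, f n m = ∑ n ∈ S, ∑ m ∈ S, ((if n = m then f n m else 0) +
        (if m < n then f n m else 0) + (if n < m then f m n else 0)) :=
        Finset.sum_congr rfl fun n _ => Finset.sum_congr rfl fun m _ => h1 n m
    _ = _ := by
        simp_rw [Finset.sum_add_distrib]
        rw [h2, h3]
        ring

lemma congWeight_comm (q n m : ℕ) : congWeight q n m = congWeight q m n := by
  simp only [congWeight, eq_comm]

lemma gcdWeight_comm (q n m : ℕ) : gcdWeight q n m = gcdWeight q m n := by
  unfold gcdWeight
  by_cases h : Nat.gcd n q = Nat.gcd m q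
  · rw [if_pos h, if_pos h.symm, h]
  · rw [if_neg h, if_neg (Ne.symm h)]

lemma sum_pairs_dvd_comm (S H : Finset ℕ) (a : ℕ → ℝ) (E : ℕ → ℕ → ℕ → ℝ) :
    ∑ n ∈ S, ∑ m ∈ S, (if m < n then a n * a m *
      ∑ h ∈ H, (if h ∣ n ∧ h ∣ m then E h n m else 0) else 0) =
    ∑ h ∈ H, ∑ p ∈ (S ×ˢ S).filter (fun p : ℕ × ℕ => p.2 < p.1 ∧ h ∣ p.1 ∧ h ∣ p.2),
      a p.1 * a p.2 * E h p.1 p.2 := by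
  simp_rw [Finset.sum_filter]
  rw [← Finset.sum_product', Finset.sum_comm]
  refine Finset.sum_congr rfl fun p _ => ?_
  by_cases hp : p.2 < p.1
  · simp only [hp, if_true, true_and, Finset.mul_sum, mul_ite, mul_zero]
  · simp [hp]

/-- The exact form of the expansion: everything but the diagonal and the deviations from the
average in progressions to small moduli is a main term. -/
lemma varV_eq (a : ℕ → ℝ) {x Q : ℝ} (hx : 0 ≤ x) (hQ : 0 < Q) :
    varV a x Q =
      ∑ n ∈ Finset.Icc 1 ⌊x⌋₊, a n ^ 2 * (((⌊Q⌋₊ - ⌊Q / 2⌋₊ : ℕ) : ℝ) -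
        ∑ h ∈ Finset.Icc 1 ⌊Q⌋₊, if h ∣ n ∧ h ∣ n then dyadicWeight Q h n n else 0) +
      2 * (∑ n ∈ Finset.Icc 1 ⌊x⌋₊, ∑ m ∈ Finset.Icc 1 ⌊x⌋₊, a n * a m *
          ∑ r ∈ Finset.Icc 1 ⌊2 * x / Q⌋₊,
            (if r * Q / 2 < (n : ℝ) - m ∧ (n : ℝ) - m ≤ r * Q then
              congWeight r n m - gcdWeight r n m else 0) +
        ∑ h ∈ Finset.Icc 1 ⌊2 * x / Q⌋₊, ∑ p ∈ (Finset.Icc 1 ⌊x⌋₊ ×ˢ Finset.Icc 1 ⌊x⌋₊).filter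
          (fun p : ℕ × ℕ => p.2 < p.1 ∧ h ∣ p.1 ∧ h ∣ p.2),
            a p.1 * a p.2 * windowWeight Q ⌊2 * x / Q⌋₊ h p.1 p.2 -
        ∑ h ∈ Finset.Icc 1 ⌊Q⌋₊, ∑ p ∈ (Finset.Icc 1 ⌊x⌋₊ ×ˢ Finset.Icc 1 ⌊x⌋₊).filter
          (fun p : ℕ × ℕ => p.2 < p.1 ∧ h ∣ p.1 ∧ h ∣ p.2),
            a p.1 * a p.2 * dyadicWeight Q h p.1 p.2) := by
  have h1 : varV a x Q = ∑ n ∈ Finset.Icc 1 ⌊x⌋₊, ∑ m ∈ Finset.Icc 1 ⌊x⌋₊, a n * a m *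
      ∑ q ∈ Finset.Ioc ⌊Q / 2⌋₊ ⌊Q⌋₊, (congWeight q n m - gcdWeight q n m) := by
    unfold varV
    rw [Finset.sum_congr rfl fun q hq => sum_variance_modulus a x
      (Nat.zero_lt_of_lt (Finset.mem_Ioc.1 hq).1), Finset.sum_comm]
    refine Finset.sum_congr rfl fun n _ => ?_
    rw [Finset.sum_comm]
    simp_rw [Finset.mul_sum]
  rw [h1, sum_symm_eq]
  · congr 1
    · refine Finset.sum_congr rfl fun n _ => ?_
      rw [Finset.sum_sub_distrib, sum_dyadic_gcdWeight hQ, ← sq]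
      simp [congWeight]
    · rw [← sum_pairs_dvd_comm, ← sum_pairs_dvd_comm, ← Finset.sum_add_distrib,
        ← Finset.sum_sub_distrib]
      congr 1
      refine Finset.sum_congr rfl fun n hn => ?_
      rw [← Finset.sum_add_distrib, ← Finset.sum_sub_distrib]
      refine Finset.sum_congr rfl fun m _ => ?_
      have hnx : (n : ℝ) ≤ x := (Nat.le_floor_iff hx).1 (Finset.mem_Icc.1 hn).2
      by_cases hmn : m < n
      · simp only [if_pos hmn]
        rw [Finset.sum_sub_distrib, sum_dyadic_gcdWeight hQ, sum_congWeight_switch hQ hmn hnx,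
          ← sum_window_gcdWeight hQ hnx, ← mul_add, ← mul_sub, ← Finset.sum_add_distrib]
        congr 2
        refine Finset.sum_congr rfl fun r _ => ?_
        split_ifs <;> ring
      · simp only [if_neg hmn]
        rw [Finset.sum_eq_zero]
        · ring
        · intro r _
          rw [if_neg]
          rintro ⟨h2, -⟩
          have : (n : ℝ) ≤ m := by exact_mod_cast not_lt.1 hmn
          have : 0 ≤ r * Q / 2 := by positivity
          linarith
  · intro n m
    simp_rw [congWeight_comm _ n m, gcdWeight_comm _ n m, mul_comm (a n)]

lemma abs_card_sub_half_le {Q : ℝ} (hQ : 0 ≤ Q) :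
    |((⌊Q⌋₊ - ⌊Q / 2⌋₊ : ℕ) : ℝ) - Q / 2| ≤ 1 := by
  rw [Nat.cast_sub (Nat.floor_le_floor (by linarith)), abs_le]
  have h1 := Nat.floor_le hQ
  have h2 := Nat.floor_le (by linarith : 0 ≤ Q / 2)
  have h3 := Nat.lt_floor_add_one Q
  have h4 := Nat.lt_floor_add_one (Q / 2)
  constructor <;> linarith

lemma dyadicWeight_nonneg (Q : ℝ) (h n m : ℕ) : 0 ≤ dyadicWeight Q h n m :=
  Finset.sum_nonneg fun _ _ => by positivity

lemma sum_dyadicWeight_diag_le {C Q : ℝ} {n : ℕ} (hC : 0 ≤ C) (hn : 0 < n)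
    (hb : ∀ h, 0 < h → dyadicWeight Q h n n ≤ C) :
    ∑ h ∈ Finset.Icc 1 ⌊Q⌋₊, (if h ∣ n ∧ h ∣ n then dyadicWeight Q h n n else 0) ≤
      C * tau n := by
  rw [← Finset.sum_filter]
  calc _ ≤ ∑ h ∈ (Finset.Icc 1 ⌊Q⌋₊).filter (fun h => h ∣ n ∧ h ∣ n), C :=
        Finset.sum_le_sum fun h hh =>
          hb h (Finset.mem_Icc.1 (Finset.mem_filter.1 hh).1).1
    _ ≤ ∑ h ∈ n.divisors, C := by
        refine Finset.sum_le_sum_of_subset_of_nonneg (fun h hh => ?_) fun _ _ _ => hC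
        exact Nat.mem_divisors.2 ⟨(Finset.mem_filter.1 hh).2.1, hn.ne'⟩
    _ = C * tau n := by
        rw [Finset.sum_const, nsmul_eq_mul, tau, mul_comm]

/-- The key expression (2.3) of the paper: if `√(2x) < Q ≤ x` are large and the real
sequence `(a_n)_{n ≤ x}` satisfies the Progressions Condition with parameter `K_prog`, then
`V(𝒜,x,Q) = (Q/2) Σ_{n ≤ x} a_n²
  + 2 Σ_{h ≤ 2x/Q} Σ_{0 ≤ l ≤ 2x/(Qh)} Σ_{(n₁,n₂) ∈ 𝒮_{h,l}} a_{n₁h} a_{n₂h} C_{n₁n₂,l+1,Q/h}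
  − 2 Σ_{2x/Q < h ≤ Q} Σ_{n₂ < n₁ ≤ x, h ∣ n₁, h ∣ n₂} a_{n₁} a_{n₂}
      Σ_{Q/(2h) < d ≤ Q/h, (n₁n₂/h²,d)=1} 1/φ(d)
  + O(Σ_{n ≤ x} a_n² τ(n) + (Σ_{n ≤ x} |a_n|)²/K_prog)`, with an absolute implied
constant. -/
theorem statement_7 :
    ∃ C : ℝ, 0 < C ∧ ∀ (x Q Kprog : ℝ) (a : ℕ → ℝ),
      C ≤ x → Real.sqrt (2 * x) < Q → Q ≤ x →
      (∀ n : ℕ, x < n → a n = 0) →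
      0 < Kprog →
      progLHS a x Q ≤ (∑ n ∈ Finset.Icc 1 ⌊x⌋₊, |a n|) ^ 2 / Kprog →
      |varV a x Q -
          (Q / 2 * ∑ n ∈ Finset.Icc 1 ⌊x⌋₊, a n ^ 2
            + 2 * ∑ h ∈ Finset.Icc 1 ⌊2 * x / Q⌋₊, ∑ l ∈ Finset.range (⌊2 * x / (Q * h)⌋₊ + 1),
                ∑ p ∈ Shl x Q h l, a (p.1 * h) * a (p.2 * h) * Cmlz (p.1 * p.2) ((l : ℝ) + 1) (Q / h)
            - 2 * ∑ h ∈ Finset.Ioc ⌊2 * x / Q⌋₊ ⌊Q⌋₊,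
                ∑ p ∈ ((Finset.Icc 1 ⌊x⌋₊ ×ˢ Finset.Icc 1 ⌊x⌋₊).filter
                  (fun p : ℕ × ℕ => p.2 < p.1 ∧ h ∣ p.1 ∧ h ∣ p.2)),
                  a p.1 * a p.2 *
                    ∑ d ∈ (Finset.Icc 1 ⌊Q / h⌋₊).filter
                      (fun d : ℕ => Q / (2 * h) < (d : ℝ) ∧ Nat.Coprime (p.1 * p.2 / (h * h)) d),
                      1 / (Nat.totient d : ℝ))|
        ≤ C * (∑ n ∈ Finset.Icc 1 ⌊x⌋₊, a n ^ 2 * (tau n : ℝ)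
            + (∑ n ∈ Finset.Icc 1 ⌊x⌋₊, |a n|) ^ 2 / Kprog) := by
  obtain ⟨C₀, hC₀, hφ⟩ := exists_sum_inv_totient_le
  refine ⟨C₀ + 5, by linarith, fun x Q Kprog a hCx hsqrt hQx _ _ hprog => ?_⟩
  have hx : 0 < x := by linarith
  have hQ : 0 < Q := (Real.sqrt_nonneg _).trans_lt hsqrt
  have hRQ : ⌊2 * x / Q⌋₊ ≤ ⌊Q⌋₊ := by
    apply Nat.floor_le_floor
    rw [div_le_iff₀ hQ, ← sq]
    exact ((Real.sqrt_lt' hQ).1 hsqrt).le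
  have hb : ∀ n h : ℕ, 0 < h → dyadicWeight Q h n n ≤ C₀ := by
    intro n h hh
    have hh' : (0 : ℝ) < h := by exact_mod_cast hh
    exact hφ (Q / h) _ (by positivity) fun d hd =>
      (dyadic_mul_iff hh d).1 (Finset.mem_filter.1 hd).2.1
  have hmain : ∑ h ∈ Finset.Icc 1 ⌊2 * x / Q⌋₊, ∑ l ∈ Finset.range (⌊2 * x / (Q * h)⌋₊ + 1),
      ∑ p ∈ Shl x Q h l, a (p.1 * h) * a (p.2 * h) * Cmlz (p.1 * p.2) ((l : ℝ) + 1) (Q / h) =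
      ∑ h ∈ Finset.Icc 1 ⌊2 * x / Q⌋₊, ∑ p ∈ (Finset.Icc 1 ⌊x⌋₊ ×ˢ Finset.Icc 1 ⌊x⌋₊).filter
          (fun p : ℕ × ℕ => p.2 < p.1 ∧ h ∣ p.1 ∧ h ∣ p.2),
            a p.1 * a p.2 * windowWeight Q ⌊2 * x / Q⌋₊ h p.1 p.2 -
      ∑ h ∈ Finset.Icc 1 ⌊2 * x / Q⌋₊, ∑ p ∈ (Finset.Icc 1 ⌊x⌋₊ ×ˢ Finset.Icc 1 ⌊x⌋₊).filter
          (fun p : ℕ × ℕ => p.2 < p.1 ∧ h ∣ p.1 ∧ h ∣ p.2),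
            a p.1 * a p.2 * dyadicWeight Q h p.1 p.2 := by
    rw [← Finset.sum_sub_distrib]
    refine Finset.sum_congr rfl fun h hh => ?_
    have hh0 : 0 < h := (Finset.mem_Icc.1 hh).1
    simp_rw [← Finset.sum_sub_distrib, ← mul_sub]
    rw [← sum_Shl_eq hx.le hQ hh0 (fun n m => a n * a m *
      (windowWeight Q ⌊2 * x / Q⌋₊ h n m - dyadicWeight Q h n m))]
    exact Finset.sum_congr rfl fun l _ => Finset.sum_congr rfl fun p hp => by
      rw [Cmlz_eq hx.le hQ hh0 hp]
  have hlarge : ∑ h ∈ Finset.Ioc ⌊2 * x / Q⌋₊ ⌊Q⌋₊,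
      ∑ p ∈ ((Finset.Icc 1 ⌊x⌋₊ ×ˢ Finset.Icc 1 ⌊x⌋₊).filter
        (fun p : ℕ × ℕ => p.2 < p.1 ∧ h ∣ p.1 ∧ h ∣ p.2)),
        a p.1 * a p.2 * ∑ d ∈ (Finset.Icc 1 ⌊Q / h⌋₊).filter
          (fun d : ℕ => Q / (2 * h) < (d : ℝ) ∧ Nat.Coprime (p.1 * p.2 / (h * h)) d),
          1 / (Nat.totient d : ℝ) =
      ∑ h ∈ Finset.Ioc ⌊2 * x / Q⌋₊ ⌊Q⌋₊,
        ∑ p ∈ (Finset.Icc 1 ⌊x⌋₊ ×ˢ Finset.Icc 1 ⌊x⌋₊).filter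
          (fun p : ℕ × ℕ => p.2 < p.1 ∧ h ∣ p.1 ∧ h ∣ p.2),
            a p.1 * a p.2 * dyadicWeight Q h p.1 p.2 := by
    refine Finset.sum_congr rfl fun h hh => Finset.sum_congr rfl fun p _ => ?_
    rw [dyadicWeight_eq_sum hQ (Nat.zero_lt_of_lt (Finset.mem_Ioc.1 hh).1)]
  have hsplit : ∀ f : ℕ → ℝ, ∑ h ∈ Finset.Icc 1 ⌊Q⌋₊, f h =
      ∑ h ∈ Finset.Icc 1 ⌊2 * x / Q⌋₊, f h + ∑ h ∈ Finset.Ioc ⌊2 * x / Q⌋₊ ⌊Q⌋₊, f h :=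
    fun f => (Finset.sum_Ioc_consecutive f (Nat.zero_le _) hRQ).symm
  have hdiag : |∑ n ∈ Finset.Icc 1 ⌊x⌋₊, a n ^ 2 * (((⌊Q⌋₊ - ⌊Q / 2⌋₊ : ℕ) : ℝ) -
        ∑ h ∈ Finset.Icc 1 ⌊Q⌋₊, if h ∣ n ∧ h ∣ n then dyadicWeight Q h n n else 0) -
        Q / 2 * ∑ n ∈ Finset.Icc 1 ⌊x⌋₊, a n ^ 2| ≤
      (C₀ + 1) * ∑ n ∈ Finset.Icc 1 ⌊x⌋₊, a n ^ 2 * (tau n : ℝ) := by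
    rw [Finset.mul_sum, ← Finset.sum_sub_distrib, Finset.mul_sum]
    refine (Finset.abs_sum_le_sum_abs _ _).trans (Finset.sum_le_sum fun n hn => ?_)
    have hn0 : 0 < n := (Finset.mem_Icc.1 hn).1
    have h1 := sum_dyadicWeight_diag_le hC₀.le hn0 (hb n)
    have h2 := abs_le.1 (abs_card_sub_half_le hQ.le)
    have h3 : 0 ≤ ∑ h ∈ Finset.Icc 1 ⌊Q⌋₊,
        (if h ∣ n ∧ h ∣ n then dyadicWeight Q h n n else 0) :=
      Finset.sum_nonneg fun h _ => by
        split_ifs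
        · exact dyadicWeight_nonneg Q h n n
        · exact le_rfl
    have h4 : (1 : ℝ) ≤ tau n := by
      exact_mod_cast Finset.card_pos.2 (Nat.nonempty_divisors.2 hn0.ne')
    rw [mul_comm (Q / 2), ← mul_sub, abs_mul, abs_of_nonneg (sq_nonneg (a n)), mul_left_comm]
    refine mul_le_mul_of_nonneg_left (abs_le.2 ?_) (sq_nonneg _)
    constructor <;> nlinarith
  have herr := abs_sum_windows_le_progLHS a hx.le hQ.le
  have hsum0 : 0 ≤ ∑ n ∈ Finset.Icc 1 ⌊x⌋₊, a n ^ 2 * (tau n : ℝ) :=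
    Finset.sum_nonneg fun _ _ => by positivity
  rw [hmain, hlarge, varV_eq a hx.le hQ, hsplit (fun h =>
    ∑ p ∈ (Finset.Icc 1 ⌊x⌋₊ ×ˢ Finset.Icc 1 ⌊x⌋₊).filter
      (fun p : ℕ × ℕ => p.2 < p.1 ∧ h ∣ p.1 ∧ h ∣ p.2),
        a p.1 * a p.2 * dyadicWeight Q h p.1 p.2)]
  have hprog0 : 0 ≤ progLHS a x Q := by
    have := (abs_nonneg _).trans herr
    linarith
  have h5 := abs_le.1 hdiag
  have h6 := abs_le.1 herr
  rw [abs_le]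
  constructor <;> nlinarith
end
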